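/- arXiv:2112.02493 — 4 statements merged into one kernel-verified Lean document; each statement's English description precedes it below -/
import Mathlib

section
/- Assume moreover that a1, a2 ≥ 2. Then for every μ ∈ P, the Weyl group orbit Wμ satisfies Wμ ∩ (P+ ∪ (−P+)) = ∅ if and only if Wμ contains an element λ = k1Λ1 − k2Λ2 with k1, k2 ∈ ℤ>0 such that either k2 ≤ k1 < (a1−1)k2 or k1 < k2 ≤ (a2−1)k1. -/
namespace HypWeyl

/-- the simple reflection `s1` on `P = ℤΛ1 ⊕ ℤΛ2`, in `(Λ1, Λ2)`-coordinates:
`s1(μ) = μ − ⟨μ, α1^∨⟩ α1` with `α1 = (2, −a2)`. -/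
def s1 (a2 : ℤ) (μ : ℤ × ℤ) : ℤ × ℤ := (-μ.1, μ.2 + a2 * μ.1)

/-- the simple reflection `s2`: `s2(μ) = μ − ⟨μ, α2^∨⟩ α2` with `α2 = (−a1, 2)`. -/
def s2 (a1 : ℤ) (μ : ℤ × ℤ) : ℤ × ℤ := (μ.1 + a1 * μ.2, -μ.2)

def refl (a1 a2 : ℤ) (b : Bool) : ℤ × ℤ → ℤ × ℤ := if b then s1 a2 else s2 a1

/-- the Weyl group orbit `Wμ` (the generators `s1, s2` are involutions, so the
group generated by them coincides with the monoid generated by them). -/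
def orbit (a1 a2 : ℤ) (μ : ℤ × ℤ) : Set (ℤ × ℤ) :=
  {ν | ∃ l : List Bool, ν = l.foldl (fun w b => refl a1 a2 b w) μ}

/-- the set `P+` of dominant integral weights. -/
def Pplus : Set (ℤ × ℤ) := {ν | 0 ≤ ν.1 ∧ 0 ≤ ν.2}

/-- the `W`-invariant quadratic form on `P` -/
def quadForm (a1 a2 : ℤ) (μ : ℤ × ℤ) : ℤ :=
  a2 * μ.1 ^ 2 + a1 * a2 * (μ.1 * μ.2) + a1 * μ.2 ^ 2

lemma quadForm_refl (a1 a2 : ℤ) (b : Bool) (μ : ℤ × ℤ) :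
    quadForm a1 a2 (refl a1 a2 b μ) = quadForm a1 a2 μ := by
  cases b <;> simp [refl, s1, s2, quadForm] <;> ring

lemma quadForm_eq_of_mem_orbit {a1 a2 : ℤ} {μ ν : ℤ × ℤ} (h : ν ∈ orbit a1 a2 μ) :
    quadForm a1 a2 ν = quadForm a1 a2 μ := by
  obtain ⟨l, rfl⟩ := h
  induction l generalizing μ with
  | nil => rfl
  | cons b l ih => rw [List.foldl_cons, ih, quadForm_refl]

lemma self_mem_orbit (a1 a2 : ℤ) (μ : ℤ × ℤ) : μ ∈ orbit a1 a2 μ := ⟨[], rfl⟩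

lemma refl_mem_orbit {a1 a2 : ℤ} {μ ν : ℤ × ℤ} (b : Bool) (h : ν ∈ orbit a1 a2 μ) :
    refl a1 a2 b ν ∈ orbit a1 a2 μ := by
  obtain ⟨l, rfl⟩ := h
  exact ⟨l ++ [b], by simp⟩

lemma s1_mem_orbit {a1 a2 x y : ℤ} {μ : ℤ × ℤ} (h : (x, y) ∈ orbit a1 a2 μ) :
    (-x, y + a2 * x) ∈ orbit a1 a2 μ := refl_mem_orbit true h

lemma s2_mem_orbit {a1 a2 x y : ℤ} {μ : ℤ × ℤ} (h : (x, y) ∈ orbit a1 a2 μ) :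
    (x + a1 * y, -y) ∈ orbit a1 a2 μ := refl_mem_orbit false h

lemma quadForm_nonneg {a1 a2 : ℤ} (ha1 : 0 ≤ a1) (ha2 : 0 ≤ a2) {ν : ℤ × ℤ}
    (h : ν ∈ Pplus ∨ -ν ∈ Pplus) : 0 ≤ quadForm a1 a2 ν := by
  have hxy : 0 ≤ ν.1 * ν.2 := by
    rcases h with ⟨h1, h2⟩ | ⟨h1, h2⟩
    · exact mul_nonneg h1 h2
    · simp only [Prod.fst_neg, Prod.snd_neg] at h1 h2
      nlinarith
  unfold quadForm
  positivity

/-- `(k1, k2)` gives a weight `k1Λ1 − k2Λ2` in the fundamental region. -/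
def InRegion (a1 a2 k1 k2 : ℤ) : Prop :=
  (k2 ≤ k1 ∧ k1 < (a1 - 1) * k2) ∨ (k1 < k2 ∧ k2 ≤ (a2 - 1) * k1)

lemma quadForm_neg_of_inRegion {a1 a2 k1 k2 : ℤ} (ha1 : 2 ≤ a1) (ha2 : 2 ≤ a2)
    (ha : 4 < a1 * a2) (h1 : 0 < k1) (h2 : 0 < k2) (h : InRegion a1 a2 k1 k2) :
    quadForm a1 a2 (k1, -k2) < 0 := by
  have hc : a1 + a2 - a1 * a2 < 0 := by
    rcases eq_or_lt_of_le ha1 with h | h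
    · subst h; linarith
    · nlinarith
  simp only [quadForm]
  rcases h with ⟨h, h'⟩ | ⟨h, h'⟩
  · have e1 : 0 ≤ a2 * ((k1 - k2) * ((a1 - 1) * k2 - k1)) :=
      mul_nonneg (by linarith) (mul_nonneg (by linarith) (by linarith))
    have e2 : 0 < (a1 * a2 - a1 - a2) * k2 ^ 2 := mul_pos (by linarith) (by positivity)
    linarith
  · have e1 : 0 ≤ a1 * ((k2 - k1) * ((a2 - 1) * k1 - k2)) :=
      mul_nonneg (by linarith) (mul_nonneg (by linarith) (by linarith))
    have e2 : 0 < (a1 * a2 - a1 - a2) * k1 ^ 2 := mul_pos (by linarith) (by positivity)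
    linarith

section Descent

variable {a1 a2 : ℤ} {μ : ℤ × ℤ}

lemma lt_of_mem_orbit_left (hav : ∀ ν ∈ orbit a1 a2 μ, ¬(ν ∈ Pplus ∨ -ν ∈ Pplus)) {x y : ℤ}
    (hy : 0 < y) (h : (x, -y) ∈ orbit a1 a2 μ) : x < a1 * y := by
  by_contra! hc
  exact hav _ (s2_mem_orbit h) (Or.inl ⟨by simp only; linarith, by simp only; linarith⟩)

lemma lt_of_mem_orbit_right (hav : ∀ ν ∈ orbit a1 a2 μ, ¬(ν ∈ Pplus ∨ -ν ∈ Pplus)) {x y : ℤ}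
    (hx : 0 < x) (h : (x, -y) ∈ orbit a1 a2 μ) : y < a2 * x := by
  by_contra! hc
  refine hav _ (s1_mem_orbit h) (Or.inr ⟨?_, ?_⟩) <;>
    simp only [Prod.fst_neg, Prod.snd_neg] <;> linarith

lemma exists_inRegion_of_le (ha1 : 2 ≤ a1) (ha : 4 < a1 * a2)
    (hav : ∀ ν ∈ orbit a1 a2 μ, ¬(ν ∈ Pplus ∨ -ν ∈ Pplus)) (n : ℕ) :
    ∀ x y : ℤ, x ≤ n → 0 < x → 0 < y → (x, -y) ∈ orbit a1 a2 μ → (a1 - 1) * y ≤ x →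
      ∃ k1 k2 : ℤ, 0 < k1 ∧ 0 < k2 ∧ (k1, -k2) ∈ orbit a1 a2 μ ∧ InRegion a1 a2 k1 k2 := by
  induction n with
  | zero => intro x y h1 h2; simp at h1; omega
  | succ n ih =>
    intro x y hn hx hy h hxy
    have hp := lt_of_mem_orbit_left hav hy h
    obtain ⟨p, rfl⟩ : ∃ p, x = a1 * y - p := ⟨a1 * y - x, by ring⟩
    have hmem : (p, -(a2 * p - y)) ∈ orbit a1 a2 μ := by
      convert s1_mem_orbit (s2_mem_orbit h) using 2 <;> ring
    have hp0 : 0 < p := by linarith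
    have hpy : p ≤ y := by linarith
    have hy' : 0 < a2 * p - y := by
      by_contra! hc
      refine hav _ hmem (Or.inl ⟨hp0.le, ?_⟩)
      simp only; linarith
    have hyx : y ≤ a1 * y - p := by nlinarith
    by_cases hreg : InRegion a1 a2 p (a2 * p - y)
    · exact ⟨_, _, hp0, hy', hmem, hreg⟩
    have hle : a2 * p - y ≤ p := by
      by_contra! hc
      exact hreg (Or.inr ⟨hc, by linarith⟩)
    have hge : (a1 - 1) * (a2 * p - y) ≤ p := by
      by_contra! hc
      exact hreg (Or.inl ⟨hle, hc⟩)
    refine ih p _ ?_ hp0 hy' hmem hge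
    by_contra! hc
    push_cast at hn
    have e1 : p = y := by linarith
    have e2 : a1 = 2 := by
      have : a1 * y = 2 * y := by linarith
      exact mul_right_cancel₀ hy.ne' this
    subst e1 e2
    nlinarith

lemma exists_inRegion_of_lt (ha2 : 2 ≤ a2)
    (hav : ∀ ν ∈ orbit a1 a2 μ, ¬(ν ∈ Pplus ∨ -ν ∈ Pplus)) (n : ℕ) :
    ∀ x y : ℤ, y ≤ n → 0 < x → 0 < y → (x, -y) ∈ orbit a1 a2 μ → (a2 - 1) * x < y →
      ∃ k1 k2 : ℤ, 0 < k1 ∧ 0 < k2 ∧ (k1, -k2) ∈ orbit a1 a2 μ ∧ InRegion a1 a2 k1 k2 := by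
  induction n with
  | zero => intro x y h1 h2 h3; simp at h1; omega
  | succ n ih =>
    intro x y hn hx hy h hxy
    have hq := lt_of_mem_orbit_right hav hx h
    obtain ⟨q, rfl⟩ : ∃ q, y = a2 * x - q := ⟨a2 * x - y, by ring⟩
    have hmem : (a1 * q - x, -q) ∈ orbit a1 a2 μ := by
      convert s2_mem_orbit (s1_mem_orbit h) using 2 <;> ring
    have hq0 : 0 < q := by linarith
    have hqx : q < x := by linarith
    have hx' : 0 < a1 * q - x := by
      by_contra! hc
      refine hav _ hmem (Or.inr ⟨?_, ?_⟩) <;>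
        simp only [Prod.fst_neg, Prod.snd_neg] <;> linarith
    have hxy' : x ≤ a2 * x - q := by nlinarith
    by_cases hreg : InRegion a1 a2 (a1 * q - x) q
    · exact ⟨_, _, hx', hq0, hmem, hreg⟩
    have hlt : a1 * q - x < q := by
      by_contra! hc
      exact hreg (Or.inl ⟨hc, by linarith⟩)
    have hgt : (a2 - 1) * (a1 * q - x) < q := by
      by_contra! hc
      exact hreg (Or.inr ⟨hlt, hc⟩)
    refine ih _ q ?_ hx' hq0 hmem hgt
    push_cast at hn
    linarith

lemma exists_mem_orbit_pos_neg (hav : ∀ ν ∈ orbit a1 a2 μ, ¬(ν ∈ Pplus ∨ -ν ∈ Pplus)) :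
    ∃ x y : ℤ, 0 < x ∧ 0 < y ∧ (x, -y) ∈ orbit a1 a2 μ := by
  have mixed : ∀ x y : ℤ, (x, y) ∈ orbit a1 a2 μ → (0 < x ∧ y < 0) ∨ (x < 0 ∧ 0 < y) := by
    intro x y h
    have h' := hav _ h
    simp only [Pplus, Set.mem_ofPred_eq, Prod.fst_neg, Prod.snd_neg] at h'
    omega
  have hself : (μ.1, μ.2) ∈ orbit a1 a2 μ := self_mem_orbit a1 a2 μ
  have hs := s1_mem_orbit hself
  rcases mixed _ _ hself with ⟨hx, hy⟩ | ⟨hx, hy⟩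
  · exact ⟨μ.1, -μ.2, hx, by linarith, by simpa using hself⟩
  · rcases mixed _ _ hs with ⟨hx', hy'⟩ | ⟨hx', hy'⟩
    · exact ⟨_, -(μ.2 + a2 * μ.1), hx', by linarith, by rw [neg_neg]; exact hs⟩
    · linarith

end Descent

end HypWeyl

open HypWeyl in
theorem orbit_avoids_dominant_iff_of_two_le
    (a1 a2 : ℤ) (ha1 : 2 ≤ a1) (ha2 : 2 ≤ a2) (ha : 4 < a1 * a2) (μ : ℤ × ℤ) :
    (∀ ν ∈ orbit a1 a2 μ, ¬(ν ∈ Pplus ∨ -ν ∈ Pplus)) ↔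
      ∃ k1 k2 : ℤ, 0 < k1 ∧ 0 < k2 ∧ (k1, -k2) ∈ orbit a1 a2 μ ∧
        ((k2 ≤ k1 ∧ k1 < (a1 - 1) * k2) ∨ (k1 < k2 ∧ k2 ≤ (a2 - 1) * k1)) := by
  constructor
  · intro hav
    obtain ⟨x, y, hx, hy, h⟩ := exists_mem_orbit_pos_neg hav
    by_cases h1 : (a1 - 1) * y ≤ x
    · exact exists_inRegion_of_le ha1 ha hav x.toNat x y (Int.self_le_toNat x) hx hy h h1
    by_cases h2 : (a2 - 1) * x < y
    · exact exists_inRegion_of_lt ha2 hav y.toNat x y (Int.self_le_toNat y) hx hy h h2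
    refine ⟨x, y, hx, hy, h, ?_⟩
    push Not at h1 h2
    exact (le_or_gt y x).imp (fun h => ⟨h, h1⟩) (fun h => ⟨h, h2⟩)
  · rintro ⟨k1, k2, hk1, hk2, hmem, hreg⟩ ν hν hP
    have hneg := quadForm_neg_of_inRegion ha1 ha2 ha hk1 hk2 hreg
    have hnonneg := quadForm_nonneg (a1 := a1) (a2 := a2) (by linarith) (by linarith) hP
    rw [quadForm_eq_of_mem_orbit hmem] at hneg
    rw [quadForm_eq_of_mem_orbit hν] at hnonneg
    exact hneg.not_ge hnonneg
end

section
/- The real sequence (t_l)_{l≥1} defined by t_{2l−1} := c_{2l}/c_{2l−1} and t_{2l} := c'_{2l+1}/c'_{2l} (for l ≥ 1), i.e. the sequence c_2/c_1, c'_3/c'_2, c_4/c_3, c'_5/c'_4, …, is strictly decreasing and converges to α; likewise the sequence (u_l)_{l≥1} defined by u_{2l−1} := c'_{2l}/c'_{2l−1} and u_{2l} := c_{2l+1}/c_{2l}, i.e. the sequence c'_2/c'_1, c_3/c_2, c'_4/c'_3, c_5/c_4, …, is strictly decreasing and converges to β. -/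
open Filter Function

namespace HypCrystal

variable (a1 a2 k1 k2 : ℤ)

/-- `i_k`: 1 if `k` is odd, 2 if `k` is even. -/
def idx (k : ℤ) : ℤ := if k % 2 = 1 then 1 else 2

/-- membership in the index set `I = {1,2}`. -/
def IsI (i : ℤ) : Prop := i = 1 ∨ i = 2

/-- `⟨α_{i_j}, α_{i_k}^∨⟩`. -/
def pairJK (j k : ℤ) : ℤ :=
  if j % 2 = k % 2 then 2 else if k % 2 = 1 then -a1 else -a2

/-- `⟨α_{i_j}, α_i^∨⟩` for `i ∈ {1,2}`. -/
def pairJI (j i : ℤ) : ℤ :=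
  if idx j = i then 2 else if i = 1 then -a1 else -a2

/-- `α_{i_j}` in the `(Λ1, Λ2)`-coordinates. -/
def alphaOf (j : ℤ) : ℤ × ℤ := if j % 2 = 1 then (2, -a2) else (-a1, 2)

/-- `⟨ν, α_i^∨⟩` for a weight `ν` in `(Λ1, Λ2)`-coordinates. -/
def pairW (ν : ℤ × ℤ) (i : ℤ) : ℤ := if i = 1 then ν.1 else ν.2

/-- the sequence `c_j`. -/
def cseq : ℕ → ℤ
  | 0 => 0
  | 1 => 1
  | j + 2 => (if j % 2 = 0 then a1 else a2) * cseq (j + 1) - cseq j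

/-- the sequence `c'_j`. -/
def cseq' : ℕ → ℤ
  | 0 => 0
  | 1 => 1
  | j + 2 => (if j % 2 = 0 then a2 else a1) * cseq' (j + 1) - cseq' j

noncomputable def alphaR : ℝ :=
  ((a1 : ℝ) * a2 + Real.sqrt ((a1 : ℝ) ^ 2 * (a2 : ℝ) ^ 2 - 4 * a1 * a2)) / (2 * a2)

noncomputable def betaR : ℝ :=
  ((a1 : ℝ) * a2 + Real.sqrt ((a1 : ℝ) ^ 2 * (a2 : ℝ) ^ 2 - 4 * a1 * a2)) / (2 * a1)

/-- `γ_k = α` if `k` even, `β` if `k` odd. -/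
noncomputable def gammaR (k : ℤ) : ℝ := if k % 2 = 0 then alphaR a1 a2 else betaR a1 a2

/-- `p_m` for `m ≥ 0`. -/
def ppos : ℕ → ℤ
  | 0 => k2
  | 1 => k1
  | m + 2 => (if m % 2 = 0 then a2 else a1) * ppos (m + 1) - ppos m

/-- `p_{-n}` for `n ≥ 0`. -/
def pneg : ℕ → ℤ
  | 0 => k2
  | 1 => a1 * k2 - k1
  | n + 2 => (if (n + 2) % 2 = 0 then a2 else a1) * pneg (n + 1) - pneg n

/-- the two-sided sequence `p_m`, `m ∈ ℤ`, with `p_0 = k2`, `p_1 = k1`. -/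
def pseq (m : ℤ) : ℤ :=
  if 0 ≤ m then ppos a1 a2 k1 k2 m.toNat else pneg a1 a2 k1 k2 (-m).toNat

/-- `λ = k1·Λ1 − k2·Λ2` in `(Λ1, Λ2)`-coordinates. -/
def lamW : ℤ × ℤ := (k1, -k2)

/-- membership in `ℤ^{+∞}` (coordinates supported on positions `≥ 1`, nonnegative,
finitely supported). -/
def ZPlusMem (x : ℤ → ℤ) : Prop :=
  (∀ k : ℤ, k ≤ 0 → x k = 0) ∧ (∀ k : ℤ, 0 ≤ x k) ∧ ∃ N : ℕ, ∀ k : ℤ, (N : ℤ) < k → x k = 0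

/-- membership in `ℤ^{−∞}` (coordinates supported on positions `≤ 0`, nonpositive,
finitely supported). -/
def ZMinusMem (x : ℤ → ℤ) : Prop :=
  (∀ k : ℤ, 1 ≤ k → x k = 0) ∧ (∀ k : ℤ, x k ≤ 0) ∧ ∃ N : ℕ, ∀ k : ℤ, k < -(N : ℤ) → x k = 0

/-- membership in `X+ = Img(Ψ⁺)`. -/
def XPlusMem (x : ℤ → ℤ) : Prop :=
  ZPlusMem x ∧ ∀ j : ℤ, 1 ≤ j →
    0 ≤ cseq a1 a2 j.toNat * x j - cseq a1 a2 (j - 1).toNat * x (j + 1)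

/-- membership in `X− = Img(Ψ⁻)`. -/
def XMinusMem (x : ℤ → ℤ) : Prop :=
  ZMinusMem x ∧ ∀ j : ℤ, j ≤ 0 →
    cseq' a1 a2 (1 - j).toNat * x j - cseq' a1 a2 (-j).toNat * x (j - 1) ≤ 0

def posPart (x : ℤ → ℤ) : ℤ → ℤ := fun k => if 1 ≤ k then x k else 0
def negPart (x : ℤ → ℤ) : ℤ → ℤ := fun k => if k ≤ 0 then x k else 0

/-- membership in `Z_ι(μ) = ℤ^{+∞} ⊗ t_μ ⊗ ℤ^{−∞}` (in coordinates). -/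
def ZMem (x : ℤ → ℤ) : Prop := ZPlusMem (posPart x) ∧ ZMinusMem (negPart x)

/-- membership in `X+ ⊗ t_λ ⊗ X−` (in coordinates). -/
def XXMem (x : ℤ → ℤ) : Prop := XPlusMem a1 a2 (posPart x) ∧ XMinusMem a1 a2 (negPart x)

/-- `σ_k` on `ℤ^{+∞}` (for `k ≥ 1`). -/
noncomputable def sigmaP (x : ℤ → ℤ) (k : ℤ) : ℤ :=
  x k + ∑ᶠ j : ℤ, if k < j then pairJK a1 a2 j k * x j else 0

/-- `σ_k` on `ℤ^{−∞}` (for `k ≤ 0`). -/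
noncomputable def sigmaM (x : ℤ → ℤ) (k : ℤ) : ℤ :=
  -(x k) - ∑ᶠ j : ℤ, if j < k then pairJK a1 a2 j k * x j else 0

/-- `−Σ_j x_j α_{i_j}` in `(Λ1, Λ2)`-coordinates. -/
noncomputable def wtOf (x : ℤ → ℤ) : ℤ × ℤ :=
  (-∑ᶠ j : ℤ, x j * (alphaOf a1 a2 j).1, -∑ᶠ j : ℤ, x j * (alphaOf a1 a2 j).2)

/-- `wt(x) = μ − Σ_j x_j α_{i_j}`. -/
noncomputable def wtZ (μ : ℤ × ℤ) (x : ℤ → ℤ) : ℤ × ℤ := μ + wtOf a1 a2 x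

/-- `σ_k` on `Z_ι(μ)`. -/
noncomputable def sigmaZ (μ : ℤ × ℤ) (x : ℤ → ℤ) (k : ℤ) : ℤ :=
  if 1 ≤ k then sigmaP a1 a2 x k
  else sigmaM a1 a2 x k - pairW (wtZ a1 a2 μ x) (idx k)

/-- `ε_i` on `Z_ι(μ)`. -/
noncomputable def epsZ (μ : ℤ × ℤ) (x : ℤ → ℤ) (i : ℤ) : ℤ :=
  sSup {s : ℤ | ∃ k : ℤ, idx k = i ∧ sigmaZ a1 a2 μ x k = s}

/-- `φ_i` on `Z_ι(μ)`. -/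
noncomputable def phiZ (μ : ℤ × ℤ) (x : ℤ → ℤ) (i : ℤ) : ℤ :=
  epsZ a1 a2 μ x i + pairW (wtZ a1 a2 μ x) i

noncomputable def kmaxZ (μ : ℤ × ℤ) (x : ℤ → ℤ) (i : ℤ) : ℤ :=
  sSup {k : ℤ | idx k = i ∧ sigmaZ a1 a2 μ x k = epsZ a1 a2 μ x i}

noncomputable def kminZ (μ : ℤ × ℤ) (x : ℤ → ℤ) (i : ℤ) : ℤ :=
  sInf {k : ℤ | idx k = i ∧ sigmaZ a1 a2 μ x k = epsZ a1 a2 μ x i}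

/-- `ẽ_i` on `Z_ι(μ)`; `none` represents `0`. -/
noncomputable def eZ (μ : ℤ × ℤ) (i : ℤ) (x : ℤ → ℤ) : Option (ℤ → ℤ) :=
  if 0 < epsZ a1 a2 μ x i then
    some (Function.update x (kmaxZ a1 a2 μ x i) (x (kmaxZ a1 a2 μ x i) - 1))
  else none

/-- `f̃_i` on `Z_ι(μ)`; `none` represents `0`. -/
noncomputable def fZ (μ : ℤ × ℤ) (i : ℤ) (x : ℤ → ℤ) : Option (ℤ → ℤ) :=
  if 0 < phiZ a1 a2 μ x i then
    some (Function.update x (kminZ a1 a2 μ x i) (x (kminZ a1 a2 μ x i) + 1))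
  else none

/-- `ε_i` on `ℤ^{+∞}`. -/
noncomputable def epsP (x : ℤ → ℤ) (i : ℤ) : ℤ :=
  sSup {s : ℤ | ∃ k : ℤ, 1 ≤ k ∧ idx k = i ∧ sigmaP a1 a2 x k = s}

noncomputable def kmaxP (x : ℤ → ℤ) (i : ℤ) : ℤ :=
  sSup {k : ℤ | 1 ≤ k ∧ idx k = i ∧ sigmaP a1 a2 x k = epsP a1 a2 x i}

noncomputable def kminP (x : ℤ → ℤ) (i : ℤ) : ℤ :=
  sInf {k : ℤ | 1 ≤ k ∧ idx k = i ∧ sigmaP a1 a2 x k = epsP a1 a2 x i}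

/-- `ẽ_i` on `ℤ^{+∞}` (partial). -/
noncomputable def eP (i : ℤ) (x : ℤ → ℤ) : Option (ℤ → ℤ) :=
  if 0 < epsP a1 a2 x i then
    some (Function.update x (kmaxP a1 a2 x i) (x (kmaxP a1 a2 x i) - 1))
  else none

/-- `f̃_i` on `ℤ^{+∞}` (total). -/
noncomputable def fP (i : ℤ) (x : ℤ → ℤ) : ℤ → ℤ :=
  Function.update x (kminP a1 a2 x i) (x (kminP a1 a2 x i) + 1)

/-- `φ_i` on `ℤ^{−∞}`. -/
noncomputable def phiMf (x : ℤ → ℤ) (i : ℤ) : ℤ :=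
  sSup {s : ℤ | ∃ k : ℤ, k ≤ 0 ∧ idx k = i ∧ sigmaM a1 a2 x k = s}

noncomputable def kmaxM (x : ℤ → ℤ) (i : ℤ) : ℤ :=
  sSup {k : ℤ | k ≤ 0 ∧ idx k = i ∧ sigmaM a1 a2 x k = phiMf a1 a2 x i}

noncomputable def kminM (x : ℤ → ℤ) (i : ℤ) : ℤ :=
  sInf {k : ℤ | k ≤ 0 ∧ idx k = i ∧ sigmaM a1 a2 x k = phiMf a1 a2 x i}

/-- `ẽ_i` on `ℤ^{−∞}` (total). -/
noncomputable def eM (i : ℤ) (x : ℤ → ℤ) : ℤ → ℤ :=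
  Function.update x (kmaxM a1 a2 x i) (x (kmaxM a1 a2 x i) - 1)

noncomputable def fPiter (i : ℤ) (n : ℕ) (x : ℤ → ℤ) : ℤ → ℤ := (fP a1 a2 i)^[n] x

noncomputable def eMiter (i : ℤ) (n : ℕ) (x : ℤ → ℤ) : ℤ → ℤ := (eM a1 a2 i)^[n] x

noncomputable def ePiterO (i : ℤ) (n : ℕ) (ox : Option (ℤ → ℤ)) : Option (ℤ → ℤ) :=
  (fun o => o.bind (eP a1 a2 i))^[n] ox

noncomputable def eZiterO (μ : ℤ × ℤ) (i : ℤ) (n : ℕ) (ox : Option (ℤ → ℤ)) : Option (ℤ → ℤ) :=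
  (fun o => o.bind (eZ a1 a2 μ i))^[n] ox

noncomputable def fZiterO (μ : ℤ × ℤ) (i : ℤ) (n : ℕ) (ox : Option (ℤ → ℤ)) : Option (ℤ → ℤ) :=
  (fun o => o.bind (fZ a1 a2 μ i))^[n] ox

noncomputable def suppBoundP (x : ℤ → ℤ) : ℕ := sInf {N : ℕ | ∀ k : ℤ, (N : ℤ) < k → x k = 0}

noncomputable def suppBoundM (x : ℤ → ℤ) : ℕ := sInf {N : ℕ | ∀ k : ℤ, k < -(N : ℤ) → x k = 0}

/-- `starPChain x n z = f̃_{i_1}^{x_1} ⋯ f̃_{i_n}^{x_n} (z)` on `ℤ^{+∞}`. -/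
noncomputable def starPChain (x : ℤ → ℤ) : ℕ → (ℤ → ℤ) → (ℤ → ℤ)
  | 0, z => z
  | n + 1, z => starPChain x n (fPiter a1 a2 (idx ((n : ℤ) + 1)) ((x ((n : ℤ) + 1)).toNat) z)

/-- the `∗`-operation on `X+`: `(x⁺)* = f̃_{i_1}^{x_1} ⋯ f̃_{i_N}^{x_N} (z_∞)`. -/
noncomputable def starP (x : ℤ → ℤ) : ℤ → ℤ :=
  starPChain a1 a2 x (suppBoundP x) (fun _ => 0)

/-- `starMChain x n z = ẽ_{i_0}^{−x_0} ⋯ ẽ_{i_{-(n-1)}}^{−x_{-(n-1)}} (z)` on `ℤ^{−∞}`. -/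
noncomputable def starMChain (x : ℤ → ℤ) : ℕ → (ℤ → ℤ) → (ℤ → ℤ)
  | 0, z => z
  | n + 1, z => starMChain x n (eMiter a1 a2 (idx (-(n : ℤ))) ((-(x (-(n : ℤ)))).toNat) z)

/-- the `∗`-operation on `X−`. -/
noncomputable def starM (x : ℤ → ℤ) : ℤ → ℤ :=
  starMChain a1 a2 x (suppBoundM x + 1) (fun _ => 0)

/-- combine a `ℤ^{+∞}`- and a `ℤ^{−∞}`-component into an element of `Z_ι(μ)`. -/
def combine (y z : ℤ → ℤ) : ℤ → ℤ := fun k => if 1 ≤ k then y k else z k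

/-- the coordinates of `x* = (x⁺)* ⊗ t_μ ⊗ (x⁻)*`. -/
noncomputable def xstarFun (x : ℤ → ℤ) : ℤ → ℤ :=
  combine (starP a1 a2 (posPart x)) (starM a1 a2 (negPart x))

/-- the weight `μ = −λ − wt(x⁺) − wt(x⁻)` of `x*`. -/
noncomputable def mustar (lam : ℤ × ℤ) (x : ℤ → ℤ) : ℤ × ℤ :=
  -lam - wtOf a1 a2 (posPart x) - wtOf a1 a2 (negPart x)

/-- `fPnegChain g n z = f̃_{i_{-(n-1)}}^{g(-(n-1))} ⋯ f̃_{i_{-1}}^{g(-1)} f̃_{i_0}^{g 0} (z)`. -/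
noncomputable def fPnegChain (g : ℤ → ℕ) : ℕ → (ℤ → ℤ) → (ℤ → ℤ)
  | 0, z => z
  | n + 1, z => fPiter a1 a2 (idx (-(n : ℤ))) (g (-(n : ℤ))) (fPnegChain g n z)

/-- `eMposChain g n z = ẽ_{i_n}^{g n} ⋯ ẽ_{i_2}^{g 2} ẽ_{i_1}^{g 1} (z)`. -/
noncomputable def eMposChain (g : ℤ → ℕ) : ℕ → (ℤ → ℤ) → (ℤ → ℤ)
  | 0, z => z
  | n + 1, z => eMiter a1 a2 (idx ((n : ℤ) + 1)) (g ((n : ℤ) + 1)) (eMposChain g n z)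

/-- `ePposChainO g n z = ẽ_{i_n}^{g n} ⋯ ẽ_{i_2}^{g 2} ẽ_{i_1}^{g 1} (z)` on `ℤ^{+∞}`. -/
noncomputable def ePposChainO (g : ℤ → ℕ) : ℕ → Option (ℤ → ℤ) → Option (ℤ → ℤ)
  | 0, z => z
  | n + 1, z => ePiterO a1 a2 (idx ((n : ℤ) + 1)) (g ((n : ℤ) + 1)) (ePposChainO g n z)

/-- the Weyl group action `S_i` on `Z_ι(μ) ∪ {0}`. -/
noncomputable def SiO (μ : ℤ × ℤ) (i : ℤ) (ob : Option (ℤ → ℤ)) : Option (ℤ → ℤ) :=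
  ob.bind fun b =>
    if 0 ≤ pairW (wtZ a1 a2 μ b) i then
      fZiterO a1 a2 μ i (pairW (wtZ a1 a2 μ b) i).toNat (some b)
    else eZiterO a1 a2 μ i (-(pairW (wtZ a1 a2 μ b) i)).toNat (some b)

/-- `SwPos μ n = S_{i_n} ⋯ S_{i_2} S_{i_1}`. -/
noncomputable def SwPos (μ : ℤ × ℤ) : ℕ → Option (ℤ → ℤ) → Option (ℤ → ℤ)
  | 0, b => b
  | n + 1, b => SiO a1 a2 μ (idx ((n : ℤ) + 1)) (SwPos μ n b)

/-- `SwNeg μ n = S_{i_{-(n-1)}} ⋯ S_{i_{-1}} S_{i_0}`. -/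
noncomputable def SwNeg (μ : ℤ × ℤ) : ℕ → Option (ℤ → ℤ) → Option (ℤ → ℤ)
  | 0, b => b
  | n + 1, b => SiO a1 a2 μ (idx (-(n : ℤ))) (SwNeg μ n b)

/-- `S_{w_k}`. -/
noncomputable def Swk (μ : ℤ × ℤ) (k : ℤ) (b : Option (ℤ → ℤ)) : Option (ℤ → ℤ) :=
  if 0 ≤ k then SwPos a1 a2 μ k.toNat b else SwNeg a1 a2 μ (-k).toNat b

/-- `b ∈ Z_ι(μ)` is extremal. -/
noncomputable def Extremal (μ : ℤ × ℤ) (b : ℤ → ℤ) : Prop :=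
  ∀ js : List ℤ, (∀ j ∈ js, IsI j) →
    ∃ b', js.foldr (SiO a1 a2 μ) (some b) = some b' ∧
      ∀ i : ℤ, IsI i →
        (0 ≤ pairW (wtZ a1 a2 μ b') i → eZ a1 a2 μ i b' = none) ∧
        (pairW (wtZ a1 a2 μ b') i ≤ 0 → fZ a1 a2 μ i b' = none)

/-- `φ(x) ≥ 0` for all `φ ∈ Ξ_ι[λ]`. -/
noncomputable def SigmaCond (x : ℤ → ℤ) : Prop :=
  (0 ≤ gammaR a1 a2 0 * (pseq a1 a2 k1 k2 0 : ℝ) + gammaR a1 a2 0 * (x 0 : ℝ) - (x 1 : ℝ)) ∧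
  (0 ≤ gammaR a1 a2 1 * (pseq a1 a2 k1 k2 1 : ℝ) + (x 0 : ℝ) - gammaR a1 a2 1 * (x 1 : ℝ)) ∧
  (∀ k : ℤ, 1 ≤ k → 0 ≤ (pseq a1 a2 k1 k2 k : ℝ) - (x k : ℝ)) ∧
  (∀ k : ℤ, 1 ≤ k → 0 ≤ gammaR a1 a2 k * (x k : ℝ) - (x (k + 1) : ℝ)) ∧
  (∀ k : ℤ, 1 ≤ k → 0 ≤ gammaR a1 a2 (k + 1) * (pseq a1 a2 k1 k2 (k + 1) : ℝ) -
      (pseq a1 a2 k1 k2 k : ℝ) + (x k : ℝ) - gammaR a1 a2 (k + 1) * (x (k + 1) : ℝ)) ∧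
  (∀ k : ℤ, k ≤ 0 → 0 ≤ (pseq a1 a2 k1 k2 k : ℝ) + (x k : ℝ)) ∧
  (∀ k : ℤ, k ≤ 0 → 0 ≤ (x (k - 1) : ℝ) - gammaR a1 a2 k * (x k : ℝ)) ∧
  (∀ k : ℤ, k ≤ 0 → 0 ≤ gammaR a1 a2 (k - 1) * (pseq a1 a2 k1 k2 (k - 1) : ℝ) -
      (pseq a1 a2 k1 k2 k : ℝ) + gammaR a1 a2 (k - 1) * (x (k - 1) : ℝ) - (x k : ℝ))

/-- membership in `Σ_ι[λ]`. -/
noncomputable def SigmaMem (x : ℤ → ℤ) : Prop :=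
  ZMem x ∧ SigmaCond a1 a2 k1 k2 x

/-- membership in `Σ'_ι[λ]`. -/
noncomputable def SigmaPrimeMem (x : ℤ → ℤ) : Prop :=
  SigmaMem a1 a2 k1 k2 x ∧ (∀ k : ℤ, k ≤ 0 → x k = 0) ∧ XPlusMem a1 a2 (posPart x)

/-- evaluation of an affine function `φ = (c, (φ_l)_l)` at `x`. -/
noncomputable def evalAff (φ : ℝ × (ℤ → ℝ)) (x : ℤ → ℤ) : ℝ :=
  φ.1 + ∑ᶠ l : ℤ, φ.2 l * (x l : ℝ)

/-- `a_{i_k}`. -/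
def aIdx (k : ℤ) : ℤ := if k % 2 = 1 then a1 else a2

/-- the affine function `b̄_k`. -/
noncomputable def bbar (lam : ℤ × ℤ) (k : ℤ) : ℝ × (ℤ → ℝ) :=
  ((if k = -1 ∨ k = 0 then -(pairW lam (idx k) : ℝ) else 0),
    fun l => (if l = k then (1 : ℝ) else 0) + (if l = k + 1 then -(aIdx a1 a2 k : ℝ) else 0) +
      (if l = k + 2 then (1 : ℝ) else 0))

/-- the operator `S̄_k` on affine functions. -/
noncomputable def SbarOp (lam : ℤ × ℤ) (k : ℤ) (φ : ℝ × (ℤ → ℝ)) : ℝ × (ℤ → ℝ) :=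
  let b := if 0 ≤ φ.2 k then bbar a1 a2 lam (k + 2) else bbar a1 a2 lam (k - 2)
  (φ.1 - φ.2 k * b.1, fun l => φ.2 l - φ.2 k * b.2 l)

end HypCrystal

namespace HypCrystal

/-- The orbit of `p` under `x ↦ p - p / x`. -/
noncomputable def ratioOrbit (p : ℝ) : ℕ → ℝ
  | 0 => p
  | n + 1 => p - p / ratioOrbit p n

/-- The larger root of `x ^ 2 - p * x + p`. -/
noncomputable def ratioLimit (p : ℝ) : ℝ := (p + √(p ^ 2 - 4 * p)) / 2

theorem ratioLimit_sq {p : ℝ} (hp : 4 < p) : ratioLimit p ^ 2 = p * ratioLimit p - p := by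
  have h := Real.sq_sqrt (show 0 ≤ p ^ 2 - 4 * p by nlinarith)
  unfold ratioLimit
  linear_combination h / 4

theorem two_lt_ratioLimit {p : ℝ} (hp : 4 < p) : 2 < ratioLimit p := by
  have h := Real.sqrt_nonneg (p ^ 2 - 4 * p)
  unfold ratioLimit
  linarith

theorem lt_ratioLimit_sq {p : ℝ} (hp : 4 < p) :
    p < ratioLimit p ^ 2 := by
  have h := Real.sqrt_pos.2 (show 0 < p ^ 2 - 4 * p by nlinarith)
  rw [ratioLimit_sq hp]
  unfold ratioLimit
  nlinarith

theorem ratioLimit_lt_ratioOrbit {p : ℝ} (hp : 4 < p) (n : ℕ) :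
    ratioLimit p < ratioOrbit p n := by
  have h2 := two_lt_ratioLimit hp
  have hsq := ratioLimit_sq hp
  induction n with
  | zero =>
    rw [ratioOrbit]
    nlinarith
  | succ n ih =>
    have hpos : 0 < ratioOrbit p n := by linarith
    rw [ratioOrbit, lt_sub_comm, div_lt_iff₀ hpos]
    have hd : 0 < p - ratioLimit p := by nlinarith
    nlinarith [mul_lt_mul_of_pos_left ih hd]

theorem ratioOrbit_pos {p : ℝ} (hp : 4 < p) (n : ℕ) : 0 < ratioOrbit p n := by
  linarith [two_lt_ratioLimit hp, ratioLimit_lt_ratioOrbit hp n]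

theorem ratioOrbit_strictAnti {p : ℝ} (hp : 4 < p) : StrictAnti (ratioOrbit p) := by
  refine strictAnti_nat_of_succ_lt fun n => ?_
  have hpos := ratioOrbit_pos hp n
  have hlt := ratioLimit_lt_ratioOrbit hp n
  have h2 := two_lt_ratioLimit hp
  have hsq := ratioLimit_sq hp
  have hp_lt := lt_ratioLimit_sq hp
  rw [ratioOrbit, sub_lt_comm, lt_div_iff₀ hpos]
  nlinarith [mul_pos (sub_pos.2 hlt) (sub_pos.2 hlt)]

theorem ratioOrbit_sub_le {p : ℝ} (hp : 4 < p) (n : ℕ) :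
    ratioOrbit p n - ratioLimit p ≤
      (p / ratioLimit p ^ 2) ^ n * (p - ratioLimit p) := by
  have h2 := two_lt_ratioLimit hp
  have hsq := ratioLimit_sq hp
  induction n with
  | zero => simp [ratioOrbit]
  | succ n ih =>
    have hlt := ratioLimit_lt_ratioOrbit hp n
    have hpos := ratioOrbit_pos hp n
    have hfix : ratioLimit p = p - p / ratioLimit p := by
      field_simp
      linarith
    calc ratioOrbit p (n + 1) - ratioLimit p
        = p / (ratioLimit p * ratioOrbit p n) * (ratioOrbit p n - ratioLimit p) := by
          conv_lhs => rw [ratioOrbit, hfix]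
          field_simp
          ring
      _ ≤ p / ratioLimit p ^ 2 * (ratioOrbit p n - ratioLimit p) := by
          rw [pow_two]
          gcongr
      _ ≤ p / ratioLimit p ^ 2 * ((p / ratioLimit p ^ 2) ^ n * (p - ratioLimit p)) := by
          gcongr
      _ = (p / ratioLimit p ^ 2) ^ (n + 1) * (p - ratioLimit p) := by ring

theorem tendsto_ratioOrbit {p : ℝ} (hp : 4 < p) :
    Tendsto (ratioOrbit p) atTop (nhds (ratioLimit p)) := by
  have h2 := two_lt_ratioLimit hp
  have hq : p / ratioLimit p ^ 2 < 1 :=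
    (div_lt_one (by positivity)).2 (lt_ratioLimit_sq hp)
  have hgeom := (tendsto_pow_atTop_nhds_zero_of_lt_one (by positivity) hq).mul_const
    (p - ratioLimit p)
  rw [zero_mul] at hgeom
  rw [← tendsto_sub_nhds_zero_iff]
  exact squeeze_zero (fun n => (sub_pos.2 (ratioLimit_lt_ratioOrbit hp n)).le)
    (ratioOrbit_sub_le hp) hgeom

theorem cseq'_eq_cseq (a1 a2 : ℤ) (n : ℕ) : cseq' a1 a2 n = cseq a2 a1 n := by
  induction n using Nat.twoStepInduction with
  | zero => rfl
  | one => rfl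
  | more n ih0 ih1 => rw [cseq', cseq, ih0, ih1]

theorem betaR_eq_alphaR (a1 a2 : ℤ) : betaR a1 a2 = alphaR a2 a1 := by
  unfold betaR alphaR
  ring_nf

theorem alphaR_eq_ratioLimit_div (a1 a2 : ℤ) :
    alphaR a1 a2 = ratioLimit ((a1 : ℝ) * a2) / a2 := by
  unfold alphaR ratioLimit
  rw [mul_pow, div_div, mul_assoc 4]

theorem cseq_pos_and_mul_eq {a1 a2 : ℤ} (ha1 : 1 ≤ a1) (ha2 : 1 ≤ a2) (ha : 4 < a1 * a2) (m : ℕ) :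
    (0 : ℝ) < cseq a1 a2 (m + 1) ∧
      (if m % 2 = 0 then (a2 : ℝ) else a1) * cseq a1 a2 (m + 2) =
        ratioOrbit ((a1 : ℝ) * a2) m * cseq a1 a2 (m + 1) := by
  have hp : (4 : ℝ) < (a1 : ℝ) * a2 := by exact_mod_cast ha
  have h1 : (0 : ℝ) < a1 := by exact_mod_cast ha1
  have h2 : (0 : ℝ) < a2 := by exact_mod_cast ha2
  induction m with
  | zero => simp [cseq, ratioOrbit, mul_comm]
  | succ m ih =>
    obtain ⟨hpos, heq⟩ := ih
    have hs := ratioOrbit_pos hp m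
    have hcoef : (0 : ℝ) < if m % 2 = 0 then (a2 : ℝ) else a1 := by split_ifs <;> assumption
    have hpos' : (0 : ℝ) < cseq a1 a2 (m + 2) :=
      pos_of_mul_pos_right (heq ▸ mul_pos hs hpos) hcoef.le
    refine ⟨hpos', ?_⟩
    have hprev : (cseq a1 a2 (m + 1) : ℝ) =
        (if m % 2 = 0 then (a2 : ℝ) else a1) * cseq a1 a2 (m + 2) /
          ratioOrbit ((a1 : ℝ) * a2) m := by
      rw [heq]
      field_simp
    rw [cseq, ratioOrbit]
    push_cast
    rw [hprev]
    rcases Nat.mod_two_eq_zero_or_one m with hm | hm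
    · have hm' : (m + 1) % 2 = 1 := by lia
      simp only [hm, hm', one_ne_zero, if_true, if_false]
      ring
    · have hm' : (m + 1) % 2 = 0 := by lia
      simp only [hm, hm', one_ne_zero, if_true, if_false]
      ring

theorem cseq_ratio_eq {a1 a2 : ℤ} (ha1 : 1 ≤ a1) (ha2 : 1 ≤ a2) (ha : 4 < a1 * a2) (m : ℕ) :
    (cseq a1 a2 (m + 2) : ℝ) / cseq a1 a2 (m + 1) =
      ratioOrbit ((a1 : ℝ) * a2) m / if m % 2 = 0 then (a2 : ℝ) else a1 := by
  obtain ⟨hpos, heq⟩ := cseq_pos_and_mul_eq ha1 ha2 ha m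
  have hcoef : (if m % 2 = 0 then (a2 : ℝ) else a1) ≠ 0 := by
    split_ifs <;> exact_mod_cast (by lia)
  rw [div_eq_div_iff hpos.ne' hcoef, ← heq, mul_comm]

/-- The sequence `c_2/c_1, c'_3/c'_2, c_4/c_3, …` is a rescaled `ratioOrbit`. -/
theorem alternating_ratio_eq {a1 a2 : ℤ} (ha1 : 1 ≤ a1) (ha2 : 1 ≤ a2) (ha : 4 < a1 * a2) (m : ℕ) :
    (if (m + 1) % 2 = 1 then (cseq a1 a2 (m + 2) : ℝ) / (cseq a1 a2 (m + 1) : ℝ)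
      else (cseq' a1 a2 (m + 2) : ℝ) / (cseq' a1 a2 (m + 1) : ℝ)) =
      ratioOrbit ((a1 : ℝ) * a2) m / a2 := by
  rw [cseq'_eq_cseq, cseq'_eq_cseq, cseq_ratio_eq ha1 ha2 ha,
    cseq_ratio_eq ha2 ha1 (by rwa [mul_comm]), mul_comm (a2 : ℝ)]
  rcases Nat.mod_two_eq_zero_or_one m with hm | hm
  · simp [hm, show (m + 1) % 2 = 1 by lia]
  · simp [hm, show (m + 1) % 2 = 0 by lia]

theorem alternating_ratio_strictAnti_tendsto {a1 a2 : ℤ} (ha1 : 1 ≤ a1) (ha2 : 1 ≤ a2)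
    (ha : 4 < a1 * a2) :
    (∀ m n : ℕ, 1 ≤ m → m < n →
        (if n % 2 = 1 then (cseq a1 a2 (n + 1) : ℝ) / (cseq a1 a2 n : ℝ)
          else (cseq' a1 a2 (n + 1) : ℝ) / (cseq' a1 a2 n : ℝ)) <
        (if m % 2 = 1 then (cseq a1 a2 (m + 1) : ℝ) / (cseq a1 a2 m : ℝ)
          else (cseq' a1 a2 (m + 1) : ℝ) / (cseq' a1 a2 m : ℝ))) ∧
    Tendsto (fun m : ℕ =>
        if m % 2 = 1 then (cseq a1 a2 (m + 1) : ℝ) / (cseq a1 a2 m : ℝ)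
          else (cseq' a1 a2 (m + 1) : ℝ) / (cseq' a1 a2 m : ℝ))
      atTop (nhds (alphaR a1 a2)) := by
  have hp : (4 : ℝ) < (a1 : ℝ) * a2 := by exact_mod_cast ha
  have h2 : (0 : ℝ) < a2 := by exact_mod_cast ha2
  constructor
  · intro m n hm hmn
    obtain ⟨m, rfl⟩ := Nat.exists_eq_add_of_le' hm
    obtain ⟨n, rfl⟩ := Nat.exists_eq_add_of_le' (hm.trans hmn.le)
    rw [alternating_ratio_eq ha1 ha2 ha, alternating_ratio_eq ha1 ha2 ha]
    exact div_lt_div_of_pos_right (ratioOrbit_strictAnti hp (by lia)) h2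
  · rw [← tendsto_add_atTop_iff_nat 1, alphaR_eq_ratioLimit_div]
    simp only [add_assoc, one_add_one_eq_two, alternating_ratio_eq ha1 ha2 ha]
    exact (tendsto_ratioOrbit hp).div_const _

end HypCrystal

open HypCrystal Filter in
theorem ratio_sequences_strictAnti_tendsto
    (a1 a2 : ℤ) (ha1 : 1 ≤ a1) (ha2 : 1 ≤ a2) (ha : 4 < a1 * a2) :
    -- `t` is the sequence `c_2/c_1, c'_3/c'_2, c_4/c_3, c'_5/c'_4, …`:
    -- its `m`-th term (`m ≥ 1`) is `c_{m+1}/c_m` for odd `m` and `c'_{m+1}/c'_m` for even `m`.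
    (∀ m n : ℕ, 1 ≤ m → m < n →
        (if n % 2 = 1 then (cseq a1 a2 (n + 1) : ℝ) / (cseq a1 a2 n : ℝ)
          else (cseq' a1 a2 (n + 1) : ℝ) / (cseq' a1 a2 n : ℝ)) <
        (if m % 2 = 1 then (cseq a1 a2 (m + 1) : ℝ) / (cseq a1 a2 m : ℝ)
          else (cseq' a1 a2 (m + 1) : ℝ) / (cseq' a1 a2 m : ℝ))) ∧
    Tendsto (fun m : ℕ =>
        if m % 2 = 1 then (cseq a1 a2 (m + 1) : ℝ) / (cseq a1 a2 m : ℝ)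
          else (cseq' a1 a2 (m + 1) : ℝ) / (cseq' a1 a2 m : ℝ))
      atTop (nhds (alphaR a1 a2)) ∧
    -- `u` is the sequence `c'_2/c'_1, c_3/c_2, c'_4/c'_3, c_5/c_4, …`:
    -- its `m`-th term (`m ≥ 1`) is `c'_{m+1}/c'_m` for odd `m` and `c_{m+1}/c_m` for even `m`.
    (∀ m n : ℕ, 1 ≤ m → m < n →
        (if n % 2 = 1 then (cseq' a1 a2 (n + 1) : ℝ) / (cseq' a1 a2 n : ℝ)
          else (cseq a1 a2 (n + 1) : ℝ) / (cseq a1 a2 n : ℝ)) <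
        (if m % 2 = 1 then (cseq' a1 a2 (m + 1) : ℝ) / (cseq' a1 a2 m : ℝ)
          else (cseq a1 a2 (m + 1) : ℝ) / (cseq a1 a2 m : ℝ))) ∧
    Tendsto (fun m : ℕ =>
        if m % 2 = 1 then (cseq' a1 a2 (m + 1) : ℝ) / (cseq' a1 a2 m : ℝ)
          else (cseq a1 a2 (m + 1) : ℝ) / (cseq a1 a2 m : ℝ))
      atTop (nhds (betaR a1 a2)) := by
  have hswap := alternating_ratio_strictAnti_tendsto ha2 ha1 (by rwa [mul_comm])
  simp only [← betaR_eq_alphaR, ← cseq'_eq_cseq a1 a2, cseq'_eq_cseq a2 a1] at hswap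
  obtain ⟨hanti, hlim⟩ := alternating_ratio_strictAnti_tendsto ha1 ha2 ha
  exact ⟨hanti, hlim, hswap⟩
end

section
/- Let x̂ = (…, x_2, x_1) ∈ X+ be such that x_m ≤ p_m for all m ≥ 1, and let l ≥ 1. Define z_1(x̂, l) ∈ ℤ^{+∞} to be the sequence whose entry at position j is p_{j−2l} for 1 ≤ j ≤ 2l and x_{j−2l} for j > 2l, i.e. z_1(x̂, l) = (…, x_2, x_1, p_0, p_{−1}, …, p_{−2l+2}, p_{−2l+1}). Then the following are equivalent: (1) z_1(x̂, l) ∈ X+; (2) c_j·x_{j−2l} − c_{j−1}·x_{j−2l+1} ≥ 0 for all j ≥ 2l+1; (3) ε_{i_j}( f̃_{i_{j+1}}^{p_{j+1}} ⋯ f̃_{i_{−1}}^{p_{−1}} f̃_{i_0}^{p_0} (x̂*) ) = 0 for all j with −2l+1 ≤ j ≤ 0. -/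
open Filter Function

namespace RankTwoCrystal

variable (A : Bool → ℤ)

/-- `⟨wt L, α_j^∨⟩` for the list `L = [x_1, x_2, …]` whose letters alternate, starting at `h`. -/
def wtPair : Bool → Bool → List ℤ → ℤ
  | _, _, [] => 0
  | h, j, x :: L => (if h = j then -2 * x else A j * x) + wtPair (!h) j L

/-- `ε_j` of the list `L`, by the tensor product rule. -/
def eps : Bool → Bool → List ℤ → ℤ
  | _, _, [] => 0
  | h, j, x :: L =>
    if h = j then max (eps (!h) j L) (x - wtPair A (!h) j L) else eps (!h) j L

/-- `φ_j = ε_j + ⟨wt, α_j^∨⟩`. -/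
def phi (h j : Bool) (L : List ℤ) : ℤ := eps A h j L + wtPair A h j L

/-- `ẽ_j^{max}`. -/
def eMax : Bool → Bool → List ℤ → List ℤ
  | _, _, [] => []
  | h, j, x :: L => (if h = j then min x (phi A (!h) j L) else x) :: eMax (!h) j L

/-- `f̃_j`. -/
def fOne : Bool → Bool → List ℤ → List ℤ
  | h, j, [] => if h = j then [1] else [0, 1]
  | h, j, x :: L =>
    if h = j then (if x < phi A (!h) j L then x :: fOne (!h) j L else (x + 1) :: L)
    else x :: fOne (!h) j L

/-- `f̃_{s}^{x_1} f̃_{s'}^{x_2} ⋯` applied to the highest weight element of the crystal of lists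
starting at the letter `h`. -/
def star (h : Bool) : Bool → List ℤ → List ℤ
  | _, [] => []
  | s, x :: L => (fOne A h s)^[x.toNat] (star h (!s) L)

/-- `cons` on lists without trailing zeros. -/
def scons (x : ℤ) : List ℤ → List ℤ
  | [] => if x = 0 then [] else [x]
  | y :: L => x :: y :: L

/-- The inequalities `c_j x_{j+1} ≤ c_{j+1} x_j` for the linear recurrence starting at `(u, v)`. -/
def Ineqs : Bool → ℤ → ℤ → List ℤ → Prop
  | _, _, _, [] => True
  | s, u, v, x :: L => u * L.headD 0 ≤ v * x ∧ Ineqs (!s) v (A s * v - u) L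

/-- The string cone. -/
def Cone : Bool → List ℤ → Prop
  | _, [] => True
  | s, x :: L => 0 ≤ x ∧ Ineqs A (!s) 1 (A s) L ∧ Cone (!s) L

variable {A}

theorem eps_nonneg (h j : Bool) (L : List ℤ) : 0 ≤ eps A h j L := by
  induction L generalizing h with
  | nil => simp [eps]
  | cons x L ih =>
    simp only [eps]
    have := ih (!h)
    split_ifs
    · exact le_max_of_le_left this
    · exact this

theorem eps_scons (h j : Bool) (x : ℤ) (L : List ℤ) :
    eps A h j (scons x L) = eps A h j (x :: L) := by
  cases L with
  | nil => by_cases hx : x = 0 <;> simp [scons, eps, wtPair, hx]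
  | cons y L => rfl

theorem fOne_ne_nil (h j : Bool) (L : List ℤ) : fOne A h j L ≠ [] := by
  cases L with
  | nil => simp only [fOne]; split_ifs <;> simp
  | cons x L => simp only [fOne]; split_ifs <;> simp

theorem scons_of_ne_nil (x : ℤ) {L : List ℤ} (hL : L ≠ []) : scons x L = x :: L := by
  cases L with
  | nil => exact absurd rfl hL
  | cons y L => rfl

theorem fOne_scons_of_ne {h j : Bool} (hj : h ≠ j) (x : ℤ) (L : List ℤ) :
    fOne A h j (scons x L) = scons x (fOne A (!h) j L) := by
  rw [scons_of_ne_nil x (fOne_ne_nil _ _ _)]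
  cases L with
  | nil =>
    have : (!h) = j := by cases h <;> cases j <;> simp_all
    by_cases hx : x = 0 <;> simp [scons, fOne, hx, hj, this]
  | cons y L => simp [scons, fOne, hj]

theorem fOne_scons_self (j : Bool) {x : ℤ} (hx : 0 ≤ x) (L : List ℤ) :
    fOne A j j (scons x L) =
      if x < phi A (!j) j L then scons x (fOne A (!j) j L) else scons (x + 1) L := by
  rw [scons_of_ne_nil x (fOne_ne_nil _ _ _)]
  cases L with
  | nil =>
    have : x + 1 ≠ 0 := by omega
    by_cases hx' : x = 0
    · simp [scons, fOne, hx', phi, eps, wtPair]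
    · simp [scons, fOne, hx', phi, eps, wtPair, this]
  | cons y L => simp [scons, fOne]

theorem wtPair_fOne (h j i : Bool) (L : List ℤ) :
    wtPair A h i (fOne A h j L) = wtPair A h i L + (if j = i then -2 else A i) := by
  induction L generalizing h with
  | nil =>
    simp only [fOne]
    cases h <;> cases j <;> cases i <;> simp [wtPair]
  | cons x L ih =>
    simp only [fOne]
    by_cases hj : h = j
    · subst hj
      by_cases hx : x < phi A (!h) h L
      · simp only [hx, if_true, wtPair, ih]; ring
      · simp only [hx, if_true, if_false, wtPair]
        by_cases hi : h = i <;> simp only [hi, if_true, if_false] <;> ring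
    · simp only [hj, if_false, wtPair, ih]; ring

theorem eps_fOne (h j : Bool) (L : List ℤ) :
    eps A h j (fOne A h j L) = eps A h j L + 1 := by
  induction L generalizing h with
  | nil =>
    cases h <;> cases j <;> simp [fOne, eps, wtPair]
  | cons x L ih =>
    simp only [fOne]
    by_cases hj : h = j
    · subst hj
      by_cases hx : x < phi A (!h) h L
      · simp only [hx, if_true, eps, ih, wtPair_fOne]
        unfold phi at hx
        omega
      · simp only [hx, if_true, if_false, eps]
        unfold phi at hx
        omega
    · simp only [hj, if_false, eps, ih]

theorem phi_fOne (h j : Bool) (L : List ℤ) :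
    phi A h j (fOne A h j L) = phi A h j L - 1 := by
  simp only [phi, eps_fOne, wtPair_fOne, if_true]; ring

theorem fOne_iterate_scons_of_ne {h j : Bool} (hj : h ≠ j) (n : ℕ) (x : ℤ) (L : List ℤ) :
    (fOne A h j)^[n] (scons x L) = scons x ((fOne A (!h) j)^[n] L) := by
  induction n generalizing L with
  | zero => rfl
  | succ n ih =>
    rw [Function.iterate_succ_apply, fOne_scons_of_ne hj, ih, ← Function.iterate_succ_apply]

theorem fOne_iterate_scons_self (j : Bool) (n : ℕ) {x : ℤ} (hx : 0 ≤ x) (L : List ℤ)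
    (hL : x ≤ phi A (!j) j L) :
    (fOne A j j)^[n] (scons x L) =
      scons (x + n - min (n : ℤ) (phi A (!j) j L - x))
        ((fOne A (!j) j)^[(min (n : ℤ) (phi A (!j) j L - x)).toNat] L) := by
  induction n generalizing x L with
  | zero =>
    have : min ((0 : ℕ) : ℤ) (phi A (!j) j L - x) = 0 := by
      simp only [Nat.cast_zero]; omega
    rw [this]; simp
  | succ n ih =>
    rw [Function.iterate_succ_apply, fOne_scons_self j hx]
    split_ifs with hlt
    · rw [ih hx _ (by rw [phi_fOne]; omega), phi_fOne, ← Function.iterate_succ_apply]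
      have h1 : min ((n + 1 : ℕ) : ℤ) (phi A (!j) j L - x) =
          min (n : ℤ) (phi A (!j) j L - 1 - x) + 1 := by push_cast; omega
      rw [h1]
      congr 1
      · push_cast; ring
      · congr 1
        omega
    · have heq : phi A (!j) j L = x := by omega
      have h1 : min ((n + 1 : ℕ) : ℤ) (phi A (!j) j L - x) = 0 := by push_cast; omega
      rw [h1]
      clear ih
      have key : ∀ (m : ℕ) (y : ℤ), x ≤ y →
          (fOne A j j)^[m] (scons y L) = scons (y + m) L := by
        intro m
        induction m with
        | zero => intro y _; simp
        | succ m ihm =>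
          intro y hy
          rw [Function.iterate_succ_apply, fOne_scons_self j (by omega), if_neg (by omega),
            ihm _ (by omega)]
          congr 1
          push_cast; ring
      rw [key n (x + 1) (by omega)]
      simp only [Int.toNat_zero, Function.iterate_zero, id]
      congr 1
      push_cast; ring

theorem wtPair_star (h s i : Bool) {L : List ℤ} (hL : ∀ x ∈ L, 0 ≤ x) :
    wtPair A h i (star A h s L) = wtPair A s i L := by
  induction L generalizing s with
  | nil => rfl
  | cons x L ih =>
    have hx : 0 ≤ x := hL x (by simp)
    have key : ∀ (n : ℕ) (M : List ℤ), wtPair A h i ((fOne A h s)^[n] M) =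
        wtPair A h i M + n * (if s = i then -2 else A i) := by
      intro n
      induction n with
      | zero => simp
      | succ n ihn =>
        intro M
        rw [Function.iterate_succ_apply, ihn, wtPair_fOne]
        push_cast; ring
    rw [star, key, ih _ (fun y hy => hL y (by simp [hy])), wtPair, Int.toNat_of_nonneg hx]
    split_ifs <;> ring

theorem sum_eMax (h j : Bool) (L : List ℤ) : (eMax A h j L).sum = L.sum - eps A h j L := by
  induction L generalizing h with
  | nil => simp [eMax, eps]
  | cons x L ih =>
    simp only [eMax, eps, List.sum_cons, ih, phi]
    split_ifs <;> omega

theorem wtPair_eMax (h j : Bool) (L : List ℤ) :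
    wtPair A h j (eMax A h j L) = wtPair A h j L + 2 * eps A h j L := by
  induction L generalizing h with
  | nil => simp [eMax, eps, wtPair]
  | cons x L ih =>
    simp only [eMax, eps, wtPair, ih, phi]
    split_ifs
    · omega
    · ring

theorem eMax_eq_self {h j : Bool} {L : List ℤ} (hL : eps A h j L = 0) : eMax A h j L = L := by
  induction L generalizing h with
  | nil => rfl
  | cons x L ih =>
    have h0 := eps_nonneg (A := A) (!h) j L
    simp only [eps] at hL
    simp only [eMax, phi]
    split_ifs at hL ⊢
    · rw [ih (by omega), min_eq_left (by omega)]
    · rw [ih hL]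

/-- The head of `ẽ_j^{max} L` when `j` is the letter of the head. -/
theorem headD_eMax_self (j : Bool) (L : List ℤ) :
    0 ≤ phi A j j L + L.headD 0 ∧ (eMax A j j L).headD 0 ≤ L.headD 0 ∧
      ((eMax A j j L).headD 0 = L.headD 0 ∨ phi A j j L + L.headD 0 = 0) := by
  cases L with
  | nil => simp [eMax, phi, eps, wtPair]
  | cons x L =>
    simp only [eMax, phi, eps, wtPair, if_true, List.headD_cons]
    omega

theorem phi_cons_of_ne {h j : Bool} (hj : h ≠ j) (x : ℤ) (L : List ℤ) :
    phi A h j (x :: L) = phi A (!h) j L + A j * x := by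
  simp only [phi, eps, wtPair, hj, if_false]; ring

/-- A condition on `(u, v)` under which the recurrence starting at `(u, v)` stays positive. -/
def Good (A : Bool → ℤ) (s : Bool) (u v : ℤ) : Prop := 0 ≤ u ∧ 0 < v ∧ 2 * u ≤ A s * v

theorem Good.next (hA : ∀ s, 0 < A s) (hAA : 4 ≤ A true * A false) {s : Bool} {u v : ℤ}
    (h : Good A s u v) : Good A (!s) v (A s * v - u) := by
  obtain ⟨h1, h2, h3⟩ := h
  have h4 : 4 ≤ A (!s) * A s := by cases s <;> simpa [mul_comm] using hAA
  have := hA s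
  have := hA (!s)
  refine ⟨h2.le, ?_, ?_⟩
  · nlinarith
  · nlinarith

theorem good_one (hA : ∀ s, 0 < A s) (hAA : 4 ≤ A true * A false) (s : Bool) :
    Good A s 1 (A (!s)) := by
  refine ⟨by norm_num, hA _, ?_⟩
  have : A s * A (!s) = A true * A false := by cases s <;> simp [mul_comm]
  omega

/-- The inequalities are insensitive to `ẽ_j^{max}` when `j` is the letter of the head. -/
theorem ineqs_eMax_self (hA : ∀ s, 0 < A s) (hAA : 4 ≤ A true * A false) (s : Bool) (u v : ℤ)
    (hg : Good A s u v) : ∀ L : List ℤ,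
    Ineqs A s u v (eMax A s s L) ↔ Ineqs A s u v L
  | [] => by simp [eMax]
  | [x] => by
    simp only [eMax, Ineqs, phi, eps, wtPair, if_true, List.headD_nil, mul_zero, and_true, add_zero]
    have := hg.2.1
    constructor
    · intro h; nlinarith [min_le_left x 0]
    · intro h
      have : 0 ≤ x := by nlinarith
      rw [min_eq_right this]; simp
  | x :: y :: M => by
    have hg1 := hg.next hA hAA
    have hg2 := hg1.next hA hAA
    have ih := ineqs_eMax_self hA hAA _ _ _ hg2 M
    have hne : (!s) ≠ s := by cases s <;> simp
    obtain ⟨d1, d2, d3⟩ := headD_eMax_self (A := A) s M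
    have hv := hg.2.1
    simp only [Bool.not_not] at ih
    simp only [eMax, Ineqs, if_true, hne, if_false, List.headD_cons, phi_cons_of_ne hne,
      Bool.not_not, ih]
    generalize phi A s s M = φ at *
    generalize (eMax A s s M).headD 0 = z' at *
    generalize M.headD 0 = z at *
    constructor
    · rintro ⟨h1, h2, h3⟩
      refine ⟨?_, ?_, h3⟩
      · nlinarith [min_le_left x (φ + A s * y)]
      · rcases d3 with d3 | d3
        · rwa [← d3]
        · nlinarith [min_le_right x (φ + A s * y)]
    · rintro ⟨h1, h2, h3⟩
      refine ⟨?_, ?_, h3⟩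
      · rcases min_choice x (φ + A s * y) with h | h <;> rw [h]
        · exact h1
        · nlinarith
      · nlinarith

/-- The inequalities under `ẽ_j^{max}` when `j` is not the letter of the head. -/
theorem ineqs_eMax_not (hA : ∀ s, 0 < A s) (hAA : 4 ≤ A true * A false) (s : Bool) (L : List ℤ) :
    Ineqs A s 1 (A (!s)) L ↔
      Ineqs A s 1 (A (!s)) (eMax A s (!s) L) ∧ 0 ≤ phi A s (!s) L := by
  cases L with
  | nil => simp [eMax, Ineqs, phi, eps, wtPair]
  | cons x M =>
    have ih := ineqs_eMax_self hA hAA _ _ _ ((good_one hA hAA s).next hA hAA) M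
    have hne : s ≠ !s := by cases s <;> simp
    obtain ⟨d1, d2, d3⟩ := headD_eMax_self (A := A) (!s) M
    simp only [eMax, Ineqs, hne, if_false, phi_cons_of_ne hne, ih]
    generalize phi A (!s) (!s) M = φ at *
    generalize (eMax A (!s) (!s) M).headD 0 = z' at *
    generalize M.headD 0 = z at *
    constructor
    · rintro ⟨h1, h2⟩
      exact ⟨⟨by linarith, h2⟩, by linarith⟩
    · rintro ⟨⟨h1, h2⟩, h3⟩
      refine ⟨?_, h2⟩
      rcases d3 with d3 | d3
      · linarith
      · linarith

theorem Cone.nonneg {s : Bool} {L : List ℤ} (hL : Cone A s L) : ∀ x ∈ L, 0 ≤ x := by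
  induction L generalizing s with
  | nil => simp
  | cons x L ih =>
    intro y hy
    rcases List.mem_cons.1 hy with rfl | hy
    · exact hL.1
    · exact ih hL.2.2 y hy

theorem Cone.eMax (hA : ∀ s, 0 < A s) (hAA : 4 ≤ A true * A false) {s : Bool} (j : Bool)
    {L : List ℤ} (hL : Cone A s L) : Cone A s (eMax A s j L) := by
  induction L generalizing s with
  | nil => trivial
  | cons x L ih =>
    obtain ⟨h1, h2, h3⟩ := hL
    have hb := ineqs_eMax_not hA hAA (!s) L
    rw [Bool.not_not] at hb
    by_cases hj : s = j
    · subst hj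
      obtain ⟨h4, h5⟩ := hb.1 h2
      simp only [RankTwoCrystal.eMax, if_true, Cone]
      exact ⟨le_min h1 h5, h4, ih h3⟩
    · have hj' : j = !s := by cases s <;> cases j <;> simp_all
      subst hj'
      simp only [RankTwoCrystal.eMax, hj, if_false, Cone]
      refine ⟨h1, ?_, ih h3⟩
      have hg := good_one hA hAA (!s)
      rw [Bool.not_not] at hg
      exact (ineqs_eMax_self hA hAA (!s) 1 (A s) hg L).2 h2

theorem eq_zero_of_eps_eq_zero {s : Bool} {L : List ℤ} (hL : ∀ x ∈ L, 0 ≤ x)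
    (h : ∀ j, eps A s j L = 0) : ∀ x ∈ L, x = 0 := by
  have wt0 : ∀ (h j : Bool) (M : List ℤ), (∀ x ∈ M, x = 0) → wtPair A h j M = 0 := by
    intro h j M
    induction M generalizing h with
    | nil => intro _; rfl
    | cons x M ih =>
      intro hM
      rw [wtPair, ih _ (fun y hy => hM y (by simp [hy])), hM x (by simp)]
      simp
  induction L generalizing s with
  | nil => simp
  | cons x L ih =>
    have hz := ih (s := !s) (fun y hy => hL y (by simp [hy])) (by
      intro j
      have := h j
      have h0 := eps_nonneg (A := A) (!s) j L
      simp only [eps] at this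
      split_ifs at this <;> omega)
    intro y hy
    rcases List.mem_cons.1 hy with rfl | hy
    · have := h s
      simp only [eps, if_true, wt0 _ _ _ hz] at this
      have := hL y (by simp)
      omega
    · exact hz y hy

theorem star_eq_nil {h s : Bool} {L : List ℤ} (hL : ∀ x ∈ L, x = 0) : star A h s L = [] := by
  induction L generalizing s with
  | nil => rfl
  | cons x L ih =>
    rw [star, hL x (by simp), ih (fun y hy => hL y (by simp [hy]))]
    rfl

theorem ineqs_of_eq_zero {s : Bool} {u v : ℤ} {L : List ℤ} (hL : ∀ x ∈ L, x = 0) :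
    Ineqs A s u v L := by
  induction L generalizing s u v with
  | nil => trivial
  | cons x L ih =>
    refine ⟨?_, ih (fun y hy => hL y (by simp [hy]))⟩
    rw [hL x (by simp)]
    cases L with
    | nil => simp
    | cons y L => simp [hL y (by simp)]

/-- `star` exchanges the first coordinate with `ε`. -/
def StarSplits (A : Bool → ℤ) (h s : Bool) (L : List ℤ) : Prop :=
  star A h s L = scons (eps A s h L) (star A (!h) s (eMax A s h L))

/-- The description of `ε = 0` for `star L` by linear inequalities. -/
def EpsStarIff (A : Bool → ℤ) (h s : Bool) (L : List ℤ) : Prop :=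
  eps A h (!s) (star A h s L) = 0 ↔ Ineqs A s 1 (A (!s)) L

theorem EpsStarIff.of_splits (hA : ∀ s, 0 < A s) (hAA : 4 ≤ A true * A false) {h s : Bool}
    {L : List ℤ} (hL : Cone A s L) (hs : StarSplits A h s L)
    (ih : EpsStarIff A (!h) s (RankTwoCrystal.eMax A s h L)) : EpsStarIff A h s L := by
  unfold EpsStarIff at *
  rw [hs, eps_scons]
  by_cases hh : h = s
  · subst hh
    have hne : h ≠ !h := by cases h <;> simp
    simp only [eps, hne, if_false]
    rw [ih, ineqs_eMax_self hA hAA h 1 _ (good_one hA hAA h)]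
  · have hh' : h = !s := by cases h <;> cases s <;> simp_all
    subst hh'
    simp only [eps, if_true]
    rw [ineqs_eMax_not hA hAA s L, ← ih, wtPair_star _ _ _ (hL.eMax hA hAA _).nonneg, wtPair_eMax]
    have := eps_nonneg (A := A) (!!s) (!s) (star A (!!s) s (RankTwoCrystal.eMax A s (!s) L))
    unfold phi
    omega

theorem StarSplits.cons (hA : ∀ s, 0 < A s) (hAA : 4 ≤ A true * A false) {h s : Bool} {x : ℤ}
    {L : List ℤ} (hL : Cone A s (x :: L)) (hs : StarSplits A h (!s) L)
    (ih : 0 < x → EpsStarIff A (!h) (!s) (RankTwoCrystal.eMax A (!s) h L)) :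
    StarSplits A h s (x :: L) := by
  unfold StarSplits at *
  obtain ⟨h1, h2, h3⟩ := hL
  have he := eps_nonneg (A := A) (!s) h L
  rw [star, hs]
  by_cases hh : h = s
  · subst hh
    have hb := ineqs_eMax_not hA hAA (!h) L
    rw [Bool.not_not] at hb
    obtain ⟨h4, h5⟩ := hb.1 h2
    simp only [eps, RankTwoCrystal.eMax, if_true, star]
    rcases h1.eq_or_lt with hx | hx
    · subst hx
      rw [min_eq_left h5, max_eq_left (by unfold phi at h5; omega)]
      rfl
    · have hz := ih hx
      unfold EpsStarIff at hz
      rw [Bool.not_not] at hz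
      have hz := hz.2 h4
      have hphi : phi A (!h) h (star A (!h) (!h) (RankTwoCrystal.eMax A (!h) h L)) =
          phi A (!h) h L + eps A (!h) h L := by
        rw [phi, hz, wtPair_star _ _ _ (h3.eMax hA hAA _).nonneg, wtPair_eMax, phi]; ring
      rw [fOne_iterate_scons_self h _ he _ (by omega), hphi, Int.toNat_of_nonneg h1]
      have e1 : phi A (!h) h L + eps A (!h) h L - eps A (!h) h L = phi A (!h) h L := by ring
      rw [e1]
      congr 1
      unfold phi
      omega
  · have hh' : s ≠ h := fun e => hh e.symm
    rw [fOne_iterate_scons_of_ne hh]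
    simp only [eps, RankTwoCrystal.eMax, hh', if_false, star]

theorem starSplits_and_epsStarIff (hA : ∀ s, 0 < A s) (hAA : 4 ≤ A true * A false) (n : ℕ) :
    ∀ (s : Bool) (L : List ℤ), Cone A s L → L.sum < n → ∀ h,
      StarSplits A h s L ∧ EpsStarIff A h s L := by
  induction n with
  | zero =>
    intro s L hL hn
    have := List.sum_nonneg hL.nonneg
    simp at hn; omega
  | succ n ih =>
    have hS : ∀ (L : List ℤ) (s : Bool), Cone A s L → L.sum < (n + 1 : ℕ) → ∀ h,
        StarSplits A h s L := by
      intro L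
      induction L with
      | nil => intro s _ _ h; simp [StarSplits, star, scons, eps, RankTwoCrystal.eMax]
      | cons x L ihL =>
        intro s hL hn h
        have hx := hL.1
        rw [List.sum_cons] at hn
        refine StarSplits.cons hA hAA hL (ihL _ hL.2.2 (by omega) h) fun hx => ?_
        refine (ih _ _ (hL.2.2.eMax hA hAA _) ?_ _).2
        rw [sum_eMax]
        have := eps_nonneg (A := A) (!s) h L
        push_cast at hn
        omega
    intro s L hL hn h
    refine ⟨hS L s hL hn h, ?_⟩
    have hpos : ∀ h, 0 < eps A s h L → EpsStarIff A h s L := by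
      intro h hp
      refine .of_splits hA hAA hL (hS L s hL hn h) (ih _ _ (hL.eMax hA hAA _) ?_ _).2
      rw [sum_eMax]
      push_cast at hn
      omega
    have hnn := fun h => eps_nonneg (A := A) s h L
    rcases (hnn h).eq_or_lt with h0 | hp
    · rcases (hnn (!h)).eq_or_lt with h0' | hp'
      · have hz := eq_zero_of_eps_eq_zero hL.nonneg (A := A) (s := s) (by
          intro j
          rcases Bool.eq_or_eq_not j h with rfl | rfl
          · exact h0.symm
          · exact h0'.symm)
        unfold EpsStarIff
        rw [star_eq_nil hz]
        simp [eps, ineqs_of_eq_zero hz]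
      · refine .of_splits hA hAA hL (hS L s hL hn h) ?_
        rw [eMax_eq_self h0.symm]
        exact hpos _ hp'
    · exact hpos h hp

theorem eps_star_eq_zero_iff (hA : ∀ s, 0 < A s) (hAA : 4 ≤ A true * A false) (h : Bool)
    {s : Bool} {L : List ℤ} (hL : Cone A s L) :
    eps A h (!s) (star A h s L) = 0 ↔ Ineqs A s 1 (A (!s)) L :=
  (starSplits_and_epsStarIff hA hAA (L.sum.toNat + 1) s L hL (by push_cast; omega) h).2

theorem Ineqs.mono (hA : ∀ s, 0 < A s) (hAA : 4 ≤ A true * A false) {s : Bool} {u v u' v' : ℤ}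
    {L : List ℤ} (hL : ∀ x ∈ L, 0 ≤ x) (hg : Good A s u v) (hu : 0 < u) (hu' : 0 ≤ u')
    (hg' : Good A s u' v')
    (hdet : u' * v ≤ u * v') (h : Ineqs A s u v L) : Ineqs A s u' v' L := by
  induction L generalizing s u v u' v' with
  | nil => trivial
  | cons x L ih =>
    obtain ⟨h1, h2⟩ := h
    have hx := hL x (by simp)
    refine ⟨?_, ih (fun y hy => hL y (by simp [hy])) (hg.next hA hAA) hg.2.1 hg'.2.1.le
      (hg'.next hA hAA) (by nlinarith) h2⟩
    have e1 := mul_le_mul_of_nonneg_left h1 hu'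
    have e2 := mul_le_mul_of_nonneg_right hdet hx
    exact le_of_mul_le_mul_left (by linarith) hu

theorem cone_iff_ineqs (hA : ∀ s, 0 < A s) (hAA : 4 ≤ A true * A false) (s : Bool) {L : List ℤ}
    (hL : ∀ x ∈ L, 0 ≤ x) : Cone A s L ↔ Ineqs A s 0 1 L := by
  induction L generalizing s with
  | nil => simp [Cone, Ineqs]
  | cons x L ih =>
    have hL' : ∀ y ∈ L, 0 ≤ y := fun y hy => hL y (by simp [hy])
    have hx := hL x (by simp)
    rw [Cone, ih _ hL', Ineqs]
    simp only [zero_mul, one_mul, mul_one, sub_zero]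
    refine ⟨fun h => ⟨h.1, h.2.1⟩, fun h => ⟨h.1, h.2, ?_⟩⟩
    have hg := good_one hA hAA (!s)
    rw [Bool.not_not] at hg
    refine Ineqs.mono hA hAA hL' hg one_pos le_rfl ⟨le_rfl, one_pos, ?_⟩ (by simp) h.2
    have := hA (!s)
    omega

end RankTwoCrystal

namespace RankTwoCrystal

open HypCrystal

/-- The letter at position `k`; `true` stands for `1` and `false` for `2`. -/
def letter (k : ℤ) : Bool := decide (k % 2 = 1)

theorem letter_succ (k : ℤ) : letter (k + 1) = !letter k := by
  unfold letter
  rcases Int.emod_two_eq_zero_or_one k with h | h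
  · have : (k + 1) % 2 = 1 := by omega
    simp [h, this]
  · have : (k + 1) % 2 = 0 := by omega
    simp [h, this]

theorem idx_eq_idx_iff (k j : ℤ) : idx k = idx j ↔ letter k = letter j := by
  unfold idx letter
  split_ifs with h1 h2 h2 <;> simp [h1, h2]

/-- The Cartan integers `a_1`, `a_2` as a function on letters. -/
def coeff (a1 a2 : ℤ) (s : Bool) : ℤ := if s then a1 else a2

/-- The list `[x_1, x_2, …]` as a function on `ℤ` supported on positive positions. -/
def toFun (L : List ℤ) (k : ℤ) : ℤ := if k ≤ 0 then 0 else L.getD (k - 1).toNat 0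

theorem pairJK_eq (a1 a2 j k : ℤ) :
    pairJK a1 a2 j k = if letter j = letter k then 2 else -coeff a1 a2 (letter k) := by
  unfold pairJK coeff letter
  rcases Int.emod_two_eq_zero_or_one j with h | h <;>
    rcases Int.emod_two_eq_zero_or_one k with h' | h' <;> simp [h, h']

theorem finsum_pairJK (a1 a2 i : ℤ) (L : List ℤ) (k : ℤ) :
    (∑ᶠ j : ℤ, if k < j then pairJK a1 a2 j i * L.getD (j - k - 1).toNat 0 else 0) =
      -wtPair (coeff a1 a2) (letter (k + 1)) (letter i) L := by
  induction L generalizing k with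
  | nil => simp [wtPair]
  | cons x L ih =>
    have hsplit : (fun j : ℤ => if k < j then
          pairJK a1 a2 j i * (x :: L).getD (j - k - 1).toNat 0 else 0) =
        fun j => (if j = k + 1 then pairJK a1 a2 (k + 1) i * x else 0) +
          (if k + 1 < j then pairJK a1 a2 j i * L.getD (j - (k + 1) - 1).toNat 0 else 0) := by
      funext j
      rcases lt_trichotomy j (k + 1) with h | h | h
      · rw [if_neg (by omega), if_neg (by omega), if_neg (by omega)]; rfl
      · subst h
        rw [if_pos (by omega), if_pos rfl, if_neg (by omega)]
        simp
      · rw [if_pos (by omega), if_neg (by omega), if_pos h]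
        have : (j - k - 1).toNat = (j - (k + 1) - 1).toNat + 1 := by omega
        rw [this, List.getD_cons_succ, zero_add]
    rw [hsplit, finsum_add_distrib, ih, finsum_eq_single _ (k + 1) (fun j hj => if_neg hj),
      if_pos rfl, pairJK_eq, wtPair, letter_succ (k + 1)]
    · split_ifs <;> ring
    · refine (Set.finite_singleton (k + 1)).subset fun j hj => ?_
      by_contra hne
      exact hj (if_neg hne)
    · refine (Set.finite_Icc (k + 1) (k + 1 + L.length)).subset fun j hj => ?_
      by_contra hne
      refine hj ?_
      beta_reduce
      split_ifs with hlt
      · rw [List.getD_eq_default _ _ (by simp at hne; have := hne (by omega); omega), mul_zero]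
      · rfl

/-- `σ` at the `n`-th entry of a list. -/
def sigma (A : Bool → ℤ) : Bool → List ℤ → ℕ → ℤ
  | _, [], _ => 0
  | h, x :: L, 0 => x - wtPair A (!h) h L
  | h, _ :: L, n + 1 => sigma A (!h) L n

theorem sigma_eq (A : Bool → ℤ) (L : List ℤ) (k : ℤ) (n : ℕ) :
    sigma A (letter k) L n =
      L.getD n 0 - wtPair A (letter (k + n + 1)) (letter (k + n)) (L.drop (n + 1)) := by
  induction L generalizing k n with
  | nil => simp [sigma, wtPair]
  | cons x L ih =>
    cases n with
    | zero => simp [sigma, letter_succ]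
    | succ n =>
      rw [sigma, ← letter_succ, ih (k + 1) n]
      simp only [List.getD_cons_succ, List.drop_succ_cons]
      push_cast
      ring_nf

theorem sigmaP_toFun (a1 a2 : ℤ) (L : List ℤ) (n : ℕ) :
    sigmaP a1 a2 (toFun L) (n + 1) = sigma (coeff a1 a2) true L n := by
  have h1 : letter 1 = true := by decide
  rw [← h1, sigma_eq, sigmaP, sub_eq_add_neg]
  have hk : (1 : ℤ) + n = n + 1 := by ring
  rw [hk, ← finsum_pairJK]
  congr 1
  · rw [toFun, if_neg (by omega)]; simp
  · refine finsum_congr fun j => ?_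
    split_ifs with hj
    · rw [toFun, if_neg (by omega), List.getD_eq_getElem?_getD, List.getD_eq_getElem?_getD,
        List.getElem?_drop]
      congr 3
      omega
    · rfl

theorem sigma_le_eps (A : Bool → ℤ) (j : Bool) (L : List ℤ) (k : ℤ) (n : ℕ)
    (hn : letter (k + n) = j) : sigma A (letter k) L n ≤ eps A (letter k) j L := by
  induction L generalizing k n with
  | nil => simp [sigma, eps]
  | cons x L ih =>
    cases n with
    | zero =>
      have : letter k = j := by simpa using hn
      subst this
      simp [sigma, eps]
    | succ n =>
      have := ih (k + 1) n (by rw [← hn]; push_cast; ring_nf)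
      rw [letter_succ] at this
      simp only [sigma, eps]
      split_ifs
      · exact le_max_of_le_left this
      · exact this

/-- The position where `f̃_j` acts. -/
theorem exists_fOne_position (A : Bool → ℤ) (j : Bool) (L : List ℤ) (k : ℤ) :
    ∃ n : ℕ, letter (k + n) = j ∧ sigma A (letter k) L n = eps A (letter k) j L ∧
      (∀ m : ℕ, letter (k + m) = j → sigma A (letter k) L m = eps A (letter k) j L → n ≤ m) ∧
      ∀ m : ℕ, (fOne A (letter k) j L).getD m 0 = L.getD m 0 + if m = n then 1 else 0 := by
  induction L generalizing k with
  | nil =>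
    by_cases hj : letter k = j
    · refine ⟨0, by simpa using hj, by simp [sigma, eps], fun m _ _ => by omega, fun m => ?_⟩
      rcases m with _ | m <;> simp [fOne, hj]
    · refine ⟨1, ?_, by simp [sigma, eps], fun m hm _ => ?_, fun m => ?_⟩
      · rw [Nat.cast_one, letter_succ]
        cases h : letter k <;> cases j <;> simp_all
      · rcases m with _ | m
        · exact absurd (by simpa using hm) hj
        · omega
      · rcases m with _ | _ | m <;> simp [fOne, hj]
  | cons x L ih =>
    obtain ⟨n, h1, h2, h3, h4⟩ := ih (k + 1)
    have hshift : ∀ m : ℕ, k + 1 + (m : ℤ) = k + (m + 1 : ℕ) := fun m => by push_cast; ring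
    rw [letter_succ] at h2 h3 h4
    simp only [hshift] at h1 h3
    by_cases hj : letter k = j
    · subst hj
      by_cases hx : x < phi A (!letter k) (letter k) L
      · have hE : eps A (letter k) (letter k) (x :: L) = eps A (!letter k) (letter k) L := by
          unfold phi at hx
          simp only [eps, if_true]
          omega
        refine ⟨n + 1, h1, by rw [hE]; exact h2, fun m hm hm' => ?_, fun m => ?_⟩
        · rw [hE] at hm'
          rcases m with _ | m
          · unfold phi at hx
            simp only [sigma] at hm'
            omega
          · exact Nat.succ_le_succ (h3 m hm hm')
        · simp only [fOne, if_true, hx]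
          rcases m with _ | m
          · simp
          · simpa only [List.getD_cons_succ, Nat.add_right_cancel_iff] using h4 m
      · refine ⟨0, by simp, ?_, fun m _ _ => by omega, fun m => ?_⟩
        · unfold phi at hx
          simp only [eps, sigma, if_true]
          omega
        · simp only [fOne, if_true, hx, if_false]
          rcases m with _ | m <;> simp
    · have hE : eps A (letter k) j (x :: L) = eps A (!letter k) j L := by simp [eps, hj]
      refine ⟨n + 1, h1, by rw [hE]; exact h2, fun m hm hm' => ?_, fun m => ?_⟩
      · rw [hE] at hm'
        rcases m with _ | m
        · exact absurd (by simpa using hm) hj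
        · exact Nat.succ_le_succ (h3 m hm hm')
      · simp only [fOne, hj, if_false]
        rcases m with _ | m
        · simp
        · simpa only [List.getD_cons_succ, Nat.add_right_cancel_iff] using h4 m

theorem epsP_toFun (a1 a2 : ℤ) (L : List ℤ) (i : ℤ) :
    epsP a1 a2 (toFun L) (idx i) = eps (coeff a1 a2) true (letter i) L := by
  have h1 : letter 1 = true := by decide
  obtain ⟨n, hn, hn', -, -⟩ := exists_fOne_position (coeff a1 a2) (letter i) L 1
  rw [h1] at hn'
  refine IsGreatest.csSup_eq ⟨⟨n + 1, by omega, ?_, ?_⟩, ?_⟩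
  · rw [idx_eq_idx_iff, ← hn, add_comm]
  · rw [sigmaP_toFun, hn']
  · rintro s ⟨k, hk, hki, rfl⟩
    obtain ⟨m, rfl⟩ : ∃ m : ℕ, k = m + 1 := ⟨(k - 1).toNat, by omega⟩
    rw [sigmaP_toFun]
    have := sigma_le_eps (coeff a1 a2) (letter i) L 1 m
      (by rw [add_comm]; exact (idx_eq_idx_iff _ _).1 hki)
    rwa [h1] at this

theorem fP_toFun (a1 a2 : ℤ) (L : List ℤ) (i : ℤ) :
    fP a1 a2 (idx i) (toFun L) = toFun (fOne (coeff a1 a2) true (letter i) L) := by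
  have h1 : letter 1 = true := by decide
  obtain ⟨n, hn, hn', hmin, hf⟩ := exists_fOne_position (coeff a1 a2) (letter i) L 1
  rw [h1] at hn' hmin hf
  have hk : kminP a1 a2 (toFun L) (idx i) = n + 1 := by
    refine IsLeast.csInf_eq ⟨⟨by omega, ?_, ?_⟩, ?_⟩
    · rw [idx_eq_idx_iff, ← hn, add_comm]
    · rw [sigmaP_toFun, epsP_toFun, hn']
    · rintro k ⟨hk, hki, hke⟩
      obtain ⟨m, rfl⟩ : ∃ m : ℕ, k = m + 1 := ⟨(k - 1).toNat, by omega⟩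
      rw [sigmaP_toFun, epsP_toFun] at hke
      have := hmin m (by rw [add_comm]; exact (idx_eq_idx_iff _ _).1 hki) hke
      omega
  funext k
  rw [fP, hk]
  by_cases hkn : k = n + 1
  · subst hkn
    rw [Function.update_self, toFun, toFun, if_neg (by omega), if_neg (by omega)]
    rw [hf, add_sub_cancel_right, Int.toNat_natCast, if_pos rfl]
  · rw [Function.update_of_ne hkn, toFun, toFun]
    split_ifs with h0
    · rfl
    · rw [hf, if_neg (by omega), add_zero]

theorem fPiter_toFun_star (a1 a2 : ℤ) (x i : ℤ) (L : List ℤ) :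
    fPiter a1 a2 (idx i) x.toNat (toFun (star (coeff a1 a2) true (!letter i) L)) =
      toFun (star (coeff a1 a2) true (letter i) (x :: L)) := by
  rw [star, fPiter]
  generalize x.toNat = n
  generalize star (coeff a1 a2) true (!letter i) L = M
  induction n generalizing M with
  | zero => rfl
  | succ n ih => rw [Function.iterate_succ_apply, Function.iterate_succ_apply, fP_toFun, ih]

/-- The list `[x_1, …, x_n]`. -/
def initList (x : ℤ → ℤ) (n : ℕ) : List ℤ := (List.range n).map fun i : ℕ => x ((i : ℤ) + 1)

theorem starPChain_toFun (a1 a2 : ℤ) (x : ℤ → ℤ) (n : ℕ) (M : List ℤ) :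
    starPChain a1 a2 x n (toFun (star (coeff a1 a2) true (letter (n + 1)) M)) =
      toFun (star (coeff a1 a2) true true (initList x n ++ M)) := by
  induction n generalizing M with
  | zero =>
    have h1 : letter 1 = true := by decide
    simp [starPChain, initList, h1]
  | succ n ih =>
    have hl : letter ((n + 1 : ℕ) + 1) = !letter (n + 1) := by
      rw [letter_succ]; push_cast; rfl
    rw [starPChain, hl, fPiter_toFun_star, ih]
    simp [initList, List.range_succ]

theorem starP_eq (a1 a2 : ℤ) (x : ℤ → ℤ) :
    starP a1 a2 x = toFun (star (coeff a1 a2) true true (initList x (suppBoundP x))) := by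
  have h := starPChain_toFun a1 a2 x (suppBoundP x) []
  rw [List.append_nil] at h
  rw [← h, starP]
  congr 1
  funext k
  simp [toFun, star]

/-- The list `[g_{1-n}, …, g_{-1}, g_0] ++ L`. -/
def prepend (g : ℤ → ℤ) (L : List ℤ) : ℕ → List ℤ
  | 0 => L
  | n + 1 => g (-n) :: prepend g L n

theorem fPnegChain_toFun (a1 a2 : ℤ) (g : ℤ → ℤ) (L : List ℤ) (n : ℕ) :
    fPnegChain a1 a2 (fun m => (g m).toNat) n (toFun (star (coeff a1 a2) true true L)) =
      toFun (star (coeff a1 a2) true (letter (1 - n)) (prepend g L n)) := by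
  induction n with
  | zero =>
    have h1 : letter 1 = true := by decide
    simp [fPnegChain, prepend, h1]
  | succ n ih =>
    have h2 : letter (1 - n) = !letter (-n) := by
      rw [← letter_succ]; congr 1; ring
    have h3 : (1 : ℤ) - (n + 1 : ℕ) = -n := by push_cast; ring
    rw [fPnegChain, ih, h2, fPiter_toFun_star, h3, prepend]

theorem getD_prepend (g : ℤ → ℤ) (L : List ℤ) (n m : ℕ) :
    (prepend g L n).getD m 0 = if m < n then g (m - n + 1) else L.getD (m - n) 0 := by
  induction n generalizing m with
  | zero => simp [prepend]
  | succ n ih =>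
    rw [prepend]
    rcases m with _ | m
    · simp
    · rw [List.getD_cons_succ, ih]
      simp only [Nat.succ_lt_succ_iff, Nat.add_sub_add_right]
      split_ifs
      · congr 1; push_cast; ring
      · rfl

theorem coeff_mul_cseq_sub (a1 a2 : ℤ) (m : ℕ) :
    coeff a1 a2 (letter (m + 1)) * cseq a1 a2 (m + 1) - cseq a1 a2 m =
      cseq a1 a2 (m + 1 + 1) := by
  rw [cseq, coeff, letter]
  by_cases hm : m % 2 = 0
  · have : ((m : ℤ) + 1) % 2 = 1 := by omega
    simp [hm, this]
  · have : ((m : ℤ) + 1) % 2 = 0 := by omega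
    simp [hm, this]

theorem cseq_nonneg {a1 a2 : ℤ} (hA : ∀ s, 0 < coeff a1 a2 s)
    (hAA : 4 ≤ coeff a1 a2 true * coeff a1 a2 false) (m : ℕ) : 0 ≤ cseq a1 a2 m := by
  have key : Good (coeff a1 a2) (letter (m + 1)) (cseq a1 a2 m) (cseq a1 a2 (m + 1)) := by
    induction m with
    | zero => exact ⟨le_rfl, one_pos, by simpa [cseq] using (hA _).le⟩
    | succ m ih =>
      have hn := ih.next hA hAA
      rwa [← letter_succ, coeff_mul_cseq_sub, ← Nat.cast_succ] at hn
  exact key.1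

theorem ineqs_iff (a1 a2 : ℤ) (L : List ℤ) (m : ℕ) :
    Ineqs (coeff a1 a2) (letter (m + 1)) (cseq a1 a2 m) (cseq a1 a2 (m + 1)) L ↔
      ∀ n : ℕ, cseq a1 a2 (m + n) * L.getD (n + 1) 0 ≤ cseq a1 a2 (m + n + 1) * L.getD n 0 := by
  induction L generalizing m with
  | nil => simp [Ineqs]
  | cons x L ih =>
    have ih' := ih (m + 1)
    push_cast at ih'
    rw [Ineqs, coeff_mul_cseq_sub, ← letter_succ, ih']
    constructor
    · rintro ⟨h1, h2⟩ n
      rcases n with _ | n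
      · cases L <;> simpa using h1
      · have := h2 n
        rw [add_right_comm m 1 n] at this
        exact this
    · intro h
      refine ⟨?_, fun n => ?_⟩
      · have := h 0
        cases L <;> simpa using this
      · rw [add_right_comm m 1 n]
        exact h (n + 1)

theorem zPlusMem_toFun {L : List ℤ} (hL : ∀ x ∈ L, 0 ≤ x) : ZPlusMem (toFun L) := by
  refine ⟨fun k hk => if_pos hk, fun k => ?_, L.length, fun k hk => ?_⟩
  · rw [toFun]
    split_ifs
    · rfl
    · rw [List.getD_eq_getElem?_getD]
      rcases h : L[(k - 1).toNat]? with _ | y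
      · simp
      · exact hL y (List.mem_of_getElem? h)
  · rw [toFun, if_neg (by omega), List.getD_eq_default _ _ (by omega)]

theorem xPlusMem_toFun_iff {a1 a2 : ℤ} (hA : ∀ s, 0 < coeff a1 a2 s)
    (hAA : 4 ≤ coeff a1 a2 true * coeff a1 a2 false) {L : List ℤ} (hL : ∀ x ∈ L, 0 ≤ x) :
    XPlusMem a1 a2 (toFun L) ↔ Cone (coeff a1 a2) true L := by
  have hI := ineqs_iff a1 a2 L 0
  have h1 : letter ((0 : ℕ) + 1) = true := by decide
  rw [h1] at hI
  simp only [zero_add, cseq] at hI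
  rw [cone_iff_ineqs hA hAA _ hL, hI]
  refine ⟨fun h n => ?_, fun h => ⟨zPlusMem_toFun hL, fun j hj => ?_⟩⟩
  · have := h.2 (n + 1) (by omega)
    rw [toFun, toFun, if_neg (by omega), if_neg (by omega)] at this
    have e1 : ((n : ℤ) + 1).toNat = n + 1 := by omega
    simp only [add_sub_cancel_right, Int.toNat_natCast, e1] at this
    linarith
  · obtain ⟨m, rfl⟩ : ∃ m : ℕ, j = m + 1 := ⟨(j - 1).toNat, by omega⟩
    have := h m
    rw [toFun, toFun, if_neg (by omega), if_neg (by omega)]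
    have e1 : ((m : ℤ) + 1).toNat = m + 1 := by omega
    simp only [add_sub_cancel_right, Int.toNat_natCast, e1]
    linarith

theorem cone_prepend_iff {a1 a2 : ℤ} (hA : ∀ s, 0 < coeff a1 a2 s)
    (hAA : 4 ≤ coeff a1 a2 true * coeff a1 a2 false) {g : ℤ → ℤ} (hg : ∀ n : ℕ, 0 ≤ g (-n))
    {L : List ℤ} (hL : Cone (coeff a1 a2) true L) (N : ℕ) :
    Cone (coeff a1 a2) (letter (1 - N)) (prepend g L N) ↔
      ∀ n < N, epsP a1 a2 (fPnegChain a1 a2 (fun m => (g m).toNat) n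
        (toFun (star (coeff a1 a2) true true L))) (idx (-n)) = 0 := by
  induction N with
  | zero =>
    have h1 : letter 1 = true := by decide
    simpa [prepend, h1] using hL
  | succ N ih =>
    have h2 : (!letter (-N)) = letter (1 - N) := by
      rw [← letter_succ]; congr 1; ring
    have h2' : letter (-N) = !letter (1 - N) := by rw [← h2, Bool.not_not]
    have h3 : (1 : ℤ) - (N + 1 : ℕ) = -N := by push_cast; ring
    rw [h3, prepend, Cone, h2, Nat.forall_lt_succ_right, ← ih,
      fPnegChain_toFun, epsP_toFun, h2']
    constructor
    · rintro ⟨-, h4, h5⟩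
      exact ⟨h5, (eps_star_eq_zero_iff hA hAA true h5).2 h4⟩
    · rintro ⟨h5, h4⟩
      exact ⟨hg N, (eps_star_eq_zero_iff hA hAA true h5).1 h4, h5⟩

theorem pseq_neg (a1 a2 k1 k2 : ℤ) (n : ℕ) : pseq a1 a2 k1 k2 (-n) = pneg a1 a2 k1 k2 n := by
  rw [pseq]
  split_ifs with h
  · obtain rfl : n = 0 := by omega
    simp [ppos, pneg]
  · simp

theorem pseq_pos {a1 a2 k1 k2 : ℤ} (hA : ∀ s, 0 < coeff a1 a2 s)
    (hAA : 4 ≤ coeff a1 a2 true * coeff a1 a2 false) (hk2 : 0 < k2)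
    (h1 : 0 < a1 * k2 - k1) (h2 : 2 * k2 ≤ a2 * (a1 * k2 - k1)) (n : ℕ) :
    0 < pseq a1 a2 k1 k2 (-n) := by
  rw [pseq_neg]
  rcases n with _ | n
  · exact hk2
  have key : Good (coeff a1 a2) (letter n) (pneg a1 a2 k1 k2 n) (pneg a1 a2 k1 k2 (n + 1)) := by
    induction n with
    | zero =>
      refine ⟨hk2.le, h1, ?_⟩
      have : letter ((0 : ℕ) : ℤ) = false := by decide
      rw [this]
      exact h2
    | succ n ih =>
      have hn := ih.next hA hAA
      rw [← letter_succ] at hn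
      push_cast
      convert hn using 1
      rw [pneg, coeff, letter]
      by_cases hm : n % 2 = 0
      · have : ¬((n : ℤ) % 2 = 1) := by omega
        simp [hm, this]
      · have : (n : ℤ) % 2 = 1 := by omega
        simp [hm, this]
  exact key.2.1

theorem pseq_one_sub (a1 a2 k1 k2 : ℤ) (n : ℕ) :
    pseq a1 a2 k1 k2 (1 - n) =
      (if n % 2 = 0 then a1 else a2) * pseq a1 a2 k1 k2 (-n) - pseq a1 a2 k1 k2 (-n - 1) := by
  have e : -(n : ℤ) - 1 = -(n + 1 : ℕ) := by push_cast; ring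
  rw [e, pseq_neg, pseq_neg]
  rcases n with _ | n
  · simp [pseq, ppos, pneg]
  · have e' : (1 : ℤ) - (n + 1 : ℕ) = -n := by push_cast; ring
    rw [e', pseq_neg, pneg]
    rcases Nat.mod_two_eq_zero_or_one n with hn | hn
    · have : (n + 1) % 2 = 1 := by omega
      simp [this, hn]
    · have : (n + 1) % 2 = 0 := by omega
      simp [this, hn]

/-- The Casoratian of the sequences `c` and `p` is constant. -/
theorem cseq_mul_pseq_sub (a1 a2 k1 k2 : ℤ) {N : ℕ} (hN : N % 2 = 0) (m : ℕ) (hm : m + 1 ≤ N) :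
    cseq a1 a2 (m + 1) * pseq a1 a2 k1 k2 (m + 1 - N) -
      cseq a1 a2 m * pseq a1 a2 k1 k2 (m + 2 - N) = pseq a1 a2 k1 k2 (1 - N) := by
  induction m with
  | zero => simp [cseq]
  | succ m ih =>
    rw [← ih (by omega)]
    have h := pseq_one_sub a1 a2 k1 k2 (N - (m + 2))
    have e1 : (1 : ℤ) - (N - (m + 2) : ℕ) = (m + 1 : ℕ) + 2 - N := by omega
    have e2 : -((N - (m + 2) : ℕ) : ℤ) = m + 2 - N := by omega
    have e3 : ((m + 1 : ℕ) : ℤ) + 1 - N = m + 2 - N := by omega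
    have e4 : ((m : ℤ) + 2 - N) - 1 = m + 1 - N := by ring
    have e5 : (N - (m + 2)) % 2 = m % 2 := by omega
    rw [e1, e2, e4, e5] at h
    rw [h, e3, cseq]
    ring

theorem eq_toFun_initList {x : ℤ → ℤ} (hx : ZPlusMem x) :
    x = toFun (initList x (suppBoundP x)) := by
  obtain ⟨h0, -, hN⟩ := hx
  have hb : ∀ k : ℤ, (suppBoundP x : ℤ) < k → x k = 0 :=
    Nat.sInf_mem (s := {N : ℕ | ∀ k : ℤ, (N : ℤ) < k → x k = 0}) hN
  funext k
  rw [toFun]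
  split_ifs with hk
  · exact h0 k hk
  · by_cases hks : k ≤ suppBoundP x
    · have hlt : (k - 1).toNat < suppBoundP x := by omega
      have e : (((k - 1).toNat : ℕ) : ℤ) + 1 = k := by omega
      rw [initList, List.getD_eq_getElem?_getD, List.getElem?_map, List.getElem?_range hlt]
      exact congrArg x e.symm
    · rw [List.getD_eq_default _ _ (by simp [initList]; omega), hb k (by omega)]

theorem initList_nonneg {x : ℤ → ℤ} (hx : ∀ k, 0 ≤ x k) (n : ℕ) : ∀ y ∈ initList x n, 0 ≤ y := by
  intro y hy
  obtain ⟨i, -, rfl⟩ := List.mem_map.1 hy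
  exact hx _

theorem toFun_prepend (g : ℤ → ℤ) (L : List ℤ) (N : ℕ) (k : ℤ) :
    toFun (prepend g L N) k =
      if k ≤ 0 then 0 else if k ≤ N then g (k - N) else toFun L (k - N) := by
  rw [toFun]
  split_ifs with h1 h2
  · rfl
  · rw [getD_prepend, if_pos (by omega)]
    congr 1
    omega
  · rw [getD_prepend, if_neg (by omega), toFun, if_neg (by omega)]
    congr 1
    omega

theorem prepend_nonneg {g : ℤ → ℤ} (hg : ∀ n : ℕ, 0 ≤ g (-n)) {L : List ℤ}
    (hL : ∀ x ∈ L, 0 ≤ x) (N : ℕ) : ∀ x ∈ prepend g L N, 0 ≤ x := by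
  induction N with
  | zero => exact hL
  | succ N ih =>
    intro x hx
    rcases List.mem_cons.1 hx with rfl | hx
    · exact hg N
    · exact ih x hx

end RankTwoCrystal

open HypCrystal in
theorem z1_mem_XPlus_iff
    (a1 a2 : ℤ) (ha1 : 1 ≤ a1) (ha2 : 1 ≤ a2) (ha : 4 < a1 * a2)
    (k1 k2 : ℤ) (hk1 : 0 < k1) (hk2 : 0 < k2)
    (hreg : 2 ≤ a1 → 2 ≤ a2 →
      (k2 ≤ k1 ∧ k1 < (a1 - 1) * k2) ∨ (k1 < k2 ∧ k2 ≤ (a2 - 1) * k1))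
    (hdeg1 : a1 = 1 → 2 * k1 ≤ k2 ∧ k2 ≤ (a2 - 2) * k1)
    (hdeg2 : a2 = 1 → 2 * k2 ≤ k1 ∧ k1 ≤ (a1 - 2) * k2)
    (x : ℤ → ℤ) (hx : XPlusMem a1 a2 x)
    (hxp : ∀ m : ℤ, 1 ≤ m → x m ≤ pseq a1 a2 k1 k2 m)
    (l : ℤ) (hl : 1 ≤ l) :
    -- `z1 = (…, x_2, x_1, p_0, p_{−1}, …, p_{−2l+1})`
    ((XPlusMem a1 a2 (fun j => if j ≤ 0 then 0 else
        if j ≤ 2 * l then pseq a1 a2 k1 k2 (j - 2 * l) else x (j - 2 * l))) ↔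
      (∀ j : ℤ, 2 * l + 1 ≤ j →
        0 ≤ cseq a1 a2 j.toNat * x (j - 2 * l) -
            cseq a1 a2 (j - 1).toNat * x (j - 2 * l + 1))) ∧
    ((XPlusMem a1 a2 (fun j => if j ≤ 0 then 0 else
        if j ≤ 2 * l then pseq a1 a2 k1 k2 (j - 2 * l) else x (j - 2 * l))) ↔
      (∀ j : ℤ, -2 * l + 1 ≤ j → j ≤ 0 →
        epsP a1 a2
          (fPnegChain a1 a2 (fun m => (pseq a1 a2 k1 k2 m).toNat) (-j).toNat
            (starP a1 a2 x))
          (idx j) = 0)) := by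
  have hA : ∀ s, 0 < RankTwoCrystal.coeff a1 a2 s := by
    intro s
    cases s <;> simp [RankTwoCrystal.coeff] <;> omega
  have hAA : 4 ≤ RankTwoCrystal.coeff a1 a2 true * RankTwoCrystal.coeff a1 a2 false := by
    simpa [RankTwoCrystal.coeff] using ha.le
  have hp : ∀ n : ℕ, 0 < pseq a1 a2 k1 k2 (-n) := by
    have h12 : 0 < a1 * k2 - k1 ∧ 2 * k2 ≤ a2 * (a1 * k2 - k1) := by
      rcases ha1.eq_or_lt with h1 | h1
      · subst h1
        obtain ⟨h3, h4⟩ := hdeg1 rfl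
        have : 5 ≤ a2 := by omega
        constructor
        · linarith
        · nlinarith
      rcases ha2.eq_or_lt with h2 | h2
      · subst h2
        obtain ⟨h3, h4⟩ := hdeg2 rfl
        constructor <;> nlinarith
      · have : k2 ≤ a1 * k2 - k1 := by
          rcases hreg h1 h2 with ⟨h3, h4⟩ | ⟨h3, h4⟩ <;> nlinarith
        constructor <;> nlinarith
    exact RankTwoCrystal.pseq_pos hA hAA hk2 h12.1 h12.2
  obtain ⟨N, hN⟩ : ∃ N : ℕ, (N : ℤ) = 2 * l := ⟨(2 * l).toNat, by omega⟩
  rw [show -2 * l + 1 = 1 - 2 * l by ring]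
  simp only [← hN]
  have hNe : N % 2 = 0 := by omega
  have hxL := RankTwoCrystal.eq_toFun_initList hx.1
  have hstar := RankTwoCrystal.starP_eq a1 a2 x
  have hLn := RankTwoCrystal.initList_nonneg hx.1.2.1 (suppBoundP x)
  generalize RankTwoCrystal.initList x (suppBoundP x) = L at hxL hstar hLn
  have hpn : ∀ n : ℕ, 0 ≤ pseq a1 a2 k1 k2 (-n) := fun n => (hp n).le
  have hLc : RankTwoCrystal.Cone (RankTwoCrystal.coeff a1 a2) true L := by
    rwa [← RankTwoCrystal.xPlusMem_toFun_iff hA hAA hLn, ← hxL]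
  have hz : (fun j : ℤ => if j ≤ 0 then 0 else
      if j ≤ N then pseq a1 a2 k1 k2 (j - N) else x (j - N)) =
      RankTwoCrystal.toFun (RankTwoCrystal.prepend (pseq a1 a2 k1 k2) L N) := by
    funext j
    rw [RankTwoCrystal.toFun_prepend, ← hxL]
  have hzn := RankTwoCrystal.prepend_nonneg hpn hLn N
  refine ⟨⟨fun h j hj => ?_, fun h => ⟨?_, fun j hj => ?_⟩⟩, ?_⟩
  · have := h.2 j (by omega)
    beta_reduce at this
    rwa [if_neg (by omega), if_neg (by omega), if_neg (by omega), if_neg (by omega),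
      show j + 1 - (N : ℤ) = j - N + 1 by ring] at this
  · rw [hz]
    exact RankTwoCrystal.zPlusMem_toFun hzn
  · beta_reduce
    rcases lt_or_ge (N : ℤ) j with hjN | hjN
    · have := h j (by omega)
      rwa [if_neg (by omega), if_neg (by omega), if_neg (by omega), if_neg (by omega),
        show j + 1 - (N : ℤ) = j - N + 1 by ring]
    · obtain ⟨m, rfl⟩ : ∃ m : ℕ, j = m + 1 := ⟨(j - 1).toNat, by omega⟩
      have hD := RankTwoCrystal.cseq_mul_pseq_sub a1 a2 k1 k2 hNe m (by omega)
      have hpos := hp (N - 1)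
      rw [show -((N - 1 : ℕ) : ℤ) = 1 - N by omega, ← hD] at hpos
      rw [if_neg (by omega), if_pos hjN, if_neg (by omega), add_sub_cancel_right,
        Int.toNat_natCast, show ((m : ℤ) + 1).toNat = m + 1 by omega]
      split_ifs with hm
      · rw [show (m : ℤ) + 1 + 1 - N = m + 2 - N by ring]
        exact hpos.le
      · have e : (m : ℤ) + 1 + 1 - N = 1 := by omega
        rw [show (m : ℤ) + 2 - N = 1 by omega] at hpos
        rw [e]
        have hc := RankTwoCrystal.cseq_nonneg hA hAA m
        nlinarith [mul_le_mul_of_nonneg_left (hxp 1 le_rfl) hc]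
  · rw [hz, RankTwoCrystal.xPlusMem_toFun_iff hA hAA hzn, hstar]
    have hl1 : RankTwoCrystal.letter (1 - N) = true := by
      have : (1 - (N : ℤ)) % 2 = 1 := by omega
      simp [RankTwoCrystal.letter, this]
    have hcone := RankTwoCrystal.cone_prepend_iff hA hAA hpn hLc N
    rw [hl1] at hcone
    rw [hcone]
    constructor
    · intro h j hj1 hj2
      have := h (-j).toNat (by omega)
      rwa [show -(((-j).toNat : ℕ) : ℤ) = j by omega] at this
    · intro h n hn
      have := h (-n) (by omega) (by omega)
      rwa [neg_neg, Int.toNat_natCast] at this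
end

section
/- Let x̂ = (…, x_2, x_1) ∈ X+ be such that x_m ≤ p_m for all m ≥ 1, and let l ≥ 1. Define z_2(x̂, l) ∈ ℤ^{−∞} to be the sequence whose entry at position j is x_{j+2l} − p_{j+2l} for −2l+1 ≤ j ≤ 0 and 0 for j ≤ −2l, i.e. z_2(x̂, l) = (x_{2l} − p_{2l}, …, x_2 − p_2, x_1 − p_1, 0, 0, …). Then the following are equivalent: (1) z_2(x̂, l) ∈ X−; (2) c'_{−j+1}·(x_{j+2l} − p_{j+2l}) − c'_{−j}·(x_{j+2l−1} − p_{j+2l−1}) ≤ 0 for all j with −2l+2 ≤ j ≤ −1; (3) φ_{i_j}( ẽ_{i_{j−1}}^{p_{j−1}−x_{j−1}} ⋯ ẽ_{i_2}^{p_2−x_2} ẽ_{i_1}^{p_1−x_1}(z_{−∞}) ) = 0 for all j with 1 ≤ j ≤ 2l. -/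
open Filter Function

namespace HypCrystal

/-- `x` vanishes at all sufficiently negative positions. -/
def Tame (x : ℤ → ℤ) : Prop := ∃ N : ℤ, ∀ k : ℤ, k < N → x k = 0

/-- lower position `j` by one. -/
def lower (x : ℤ → ℤ) (j : ℤ) : ℤ → ℤ := Function.update x j (x j - 1)

/-- `x` and `y` have the same entries at all positions `≤ L`. -/
def Agree (L : ℤ) (x y : ℤ → ℤ) : Prop := ∀ k : ℤ, k ≤ L → x k = y k

/-- `φ_i` computed from the positions `≤ L`. -/
noncomputable def phiC (a1 a2 L i : ℤ) (x : ℤ → ℤ) : ℤ :=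
  sSup {s : ℤ | ∃ k : ℤ, k ≤ L ∧ idx k = i ∧ sigmaM a1 a2 x k = s}

noncomputable def kmaxC (a1 a2 L i : ℤ) (x : ℤ → ℤ) : ℤ :=
  sSup {k : ℤ | k ≤ L ∧ idx k = i ∧ sigmaM a1 a2 x k = phiC a1 a2 L i x}

/-- `ẽ_i` on the subcrystal of positions `≤ L`. -/
noncomputable def eC (a1 a2 L i : ℤ) (x : ℤ → ℤ) : ℤ → ℤ := lower x (kmaxC a1 a2 L i x)

/-- `ẽ^{y_{j-1}} ⋯ ẽ^{y_0}` applied to the zero sequence, the colour of `y_m` being `i_{L+m}`. -/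
noncomputable def chainC (a1 a2 L : ℤ) (y : ℕ → ℕ) : ℕ → ℤ → ℤ
  | 0 => fun _ => 0
  | j + 1 => (eC a1 a2 L (idx (L + j)))^[y j] (chainC a1 a2 L y j)

/-- the first `n` exponents of `y` form a string for the subcrystal of positions `≤ L`. -/
def IsString (a1 a2 L : ℤ) (y : ℕ → ℕ) (n : ℕ) : Prop :=
  ∀ j : ℕ, j < n → phiC a1 a2 L (idx (L + j)) (chainC a1 a2 L y j) = 0

/-- the value of `σ_L` along the chain of a string. -/
def topSigma (a : ℤ) (y : ℕ → ℕ) : ℕ → ℤ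
  | 0 => 0
  | j + 1 => if j % 2 = 0 then topSigma a y j + y j + min (y j : ℤ) (-topSigma a y j)
      else topSigma a y j - a * y j

/-- the part of the exponent `y_j` acting below the top position. -/
def below (a : ℤ) (y : ℕ → ℕ) (j : ℕ) : ℕ :=
  if j % 2 = 0 then min (y j) (-topSigma a y j).toNat else y j

/-- `c` or `c'`, according to the colour `i_e`. -/
def dseq (a1 a2 e : ℤ) (n : ℕ) : ℤ := if e % 2 = 1 then cseq a1 a2 n else cseq' a1 a2 n

theorem idx_eq_idx {j k : ℤ} : idx j = idx k ↔ j % 2 = k % 2 := by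
  unfold idx
  split_ifs <;> simp <;> omega

theorem Tame.zero : Tame (fun _ => 0) := ⟨0, fun _ _ => rfl⟩

theorem Tame.lower {x : ℤ → ℤ} (hx : Tame x) (j : ℤ) : Tame (lower x j) := by
  obtain ⟨N, hN⟩ := hx
  refine ⟨min N j, fun k hk => ?_⟩
  rw [HypCrystal.lower, Function.update_of_ne (by omega), hN k (by omega)]

theorem Tame.finite {x : ℤ → ℤ} (hx : Tame x) (a1 a2 k : ℤ) :
    (Function.support fun j : ℤ => if j < k then pairJK a1 a2 j k * x j else 0).Finite := by
  obtain ⟨N, hN⟩ := hx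
  refine (Set.finite_Icc N k).subset fun j hj => ?_
  by_contra h
  refine hj ?_
  by_cases hjk : j < k
  · have : j < N := by
      by_contra h'
      exact h ⟨by omega, by omega⟩
    simp [hN j this]
  · simp [hjk]

section Sigma

variable (a1 a2 : ℤ)

theorem sigmaM_zero (k : ℤ) : sigmaM a1 a2 (fun _ => 0) k = 0 := by
  simp [sigmaM]

theorem sigmaM_congr {x y : ℤ → ℤ} {L k : ℤ} (h : Agree L x y) (hk : k ≤ L) :
    sigmaM a1 a2 x k = sigmaM a1 a2 y k := by
  unfold sigmaM
  rw [h k hk]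
  congr 2
  funext j
  split_ifs with hj
  · rw [h j (by omega)]
  · rfl

theorem sigmaM_lower_of_gt (x : ℤ → ℤ) {j k : ℤ} (h : k < j) :
    sigmaM a1 a2 (lower x j) k = sigmaM a1 a2 x k :=
  sigmaM_congr a1 a2 (L := k)
    (fun m hm => by rw [lower, Function.update_of_ne (by omega)]) le_rfl

theorem sigmaM_lower_self (x : ℤ → ℤ) (j : ℤ) :
    sigmaM a1 a2 (lower x j) j = sigmaM a1 a2 x j + 1 := by
  unfold sigmaM
  have : (fun m : ℤ => if m < j then pairJK a1 a2 m j * lower x j m else 0) =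
      fun m : ℤ => if m < j then pairJK a1 a2 m j * x m else 0 := by
    funext m
    split_ifs with hm
    · rw [lower, Function.update_of_ne (by omega)]
    · rfl
  rw [this]
  simp only [lower, Function.update_self]
  ring

theorem sigmaM_lower_of_lt {x : ℤ → ℤ} (hx : Tame x) {j k : ℤ} (h : j < k) :
    sigmaM a1 a2 (lower x j) k = sigmaM a1 a2 x k + pairJK a1 a2 j k := by
  unfold sigmaM
  have hs : (fun m : ℤ => if m < k then pairJK a1 a2 m k * lower x j m else 0) =
      fun m : ℤ => (if m < k then pairJK a1 a2 m k * x m else 0) -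
        (if m = j then pairJK a1 a2 j k else 0) := by
    funext m
    by_cases hm : m = j
    · subst hm
      simp only [h, lower, Function.update_self, if_true]
      ring
    · simp [hm, lower]
  have hf : (Function.support fun m : ℤ => if m = j then pairJK a1 a2 j k else 0).Finite :=
    (Set.finite_singleton j).subset fun m hm => by
      by_contra h'
      exact hm (if_neg h')
  rw [hs, finsum_sub_distrib (hx.finite a1 a2 k) hf, finsum_eq_single _ j (fun m hm => if_neg hm),
    if_pos rfl, lower, Function.update_of_ne (by omega)]
  ring

theorem Tame.exists_sigmaM_eq_zero {x : ℤ → ℤ} (hx : Tame x) :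
    ∃ N : ℤ, ∀ k : ℤ, k < N → sigmaM a1 a2 x k = 0 := by
  obtain ⟨N, hN⟩ := hx
  refine ⟨N, fun k hk => ?_⟩
  rw [← sigmaM_zero a1 a2 k]
  exact sigmaM_congr a1 a2 (L := k) (fun m hm => hN m (by omega)) le_rfl

end Sigma

section Cut

variable (a1 a2 : ℤ)

theorem exists_idx_le (N e : ℤ) : ∃ k : ℤ, k ≤ N ∧ idx k = idx e := by
  by_cases h : N % 2 = e % 2
  · exact ⟨N, le_rfl, idx_eq_idx.2 h⟩
  · exact ⟨N - 1, by omega, idx_eq_idx.2 (by omega)⟩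

theorem phiC_isGreatest {x : ℤ → ℤ} (hx : Tame x) (L e : ℤ) :
    IsGreatest {s : ℤ | ∃ k : ℤ, k ≤ L ∧ idx k = idx e ∧ sigmaM a1 a2 x k = s}
      (phiC a1 a2 L (idx e) x) := by
  have hne : {s : ℤ | ∃ k : ℤ, k ≤ L ∧ idx k = idx e ∧ sigmaM a1 a2 x k = s}.Nonempty := by
    obtain ⟨k, hk, hke⟩ := exists_idx_le L e
    exact ⟨_, k, hk, hke, rfl⟩
  have hfin : {s : ℤ | ∃ k : ℤ, k ≤ L ∧ idx k = idx e ∧ sigmaM a1 a2 x k = s}.Finite := by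
    obtain ⟨N, hN⟩ := hx.exists_sigmaM_eq_zero a1 a2
    refine (((Set.finite_Icc N L).image (sigmaM a1 a2 x)).insert 0).subset ?_
    rintro s ⟨k, hk, -, rfl⟩
    by_cases h : k < N
    · exact Or.inl (hN k h)
    · exact Or.inr ⟨k, ⟨by omega, hk⟩, rfl⟩
  exact ⟨Int.csSup_mem hne hfin.bddAbove, fun s hs => le_csSup hfin.bddAbove hs⟩

theorem sigmaM_le_phiC {x : ℤ → ℤ} (hx : Tame x) {L e k : ℤ} (hk : k ≤ L)
    (hke : idx k = idx e) : sigmaM a1 a2 x k ≤ phiC a1 a2 L (idx e) x :=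
  (phiC_isGreatest a1 a2 hx L e).2 ⟨k, hk, hke, rfl⟩

theorem phiC_nonneg {x : ℤ → ℤ} (hx : Tame x) (L e : ℤ) : 0 ≤ phiC a1 a2 L (idx e) x := by
  obtain ⟨N, hN⟩ := hx.exists_sigmaM_eq_zero a1 a2
  obtain ⟨k, hk, hke⟩ := exists_idx_le (min (N - 1) L) e
  rw [← hN k (by omega)]
  exact sigmaM_le_phiC a1 a2 hx (by omega) hke

theorem kmaxC_isGreatest {x : ℤ → ℤ} (hx : Tame x) (L e : ℤ) :
    IsGreatest {k : ℤ | k ≤ L ∧ idx k = idx e ∧ sigmaM a1 a2 x k = phiC a1 a2 L (idx e) x}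
      (kmaxC a1 a2 L (idx e) x) := by
  have hb : BddAbove
      {k : ℤ | k ≤ L ∧ idx k = idx e ∧ sigmaM a1 a2 x k = phiC a1 a2 L (idx e) x} :=
    ⟨L, fun k hk => hk.1⟩
  exact ⟨Int.csSup_mem (phiC_isGreatest a1 a2 hx L e).1 hb, fun s hs => le_csSup hb hs⟩

theorem Tame.eC {x : ℤ → ℤ} (hx : Tame x) (L i : ℤ) : Tame (eC a1 a2 L i x) := hx.lower _

theorem Tame.eC_iterate {x : ℤ → ℤ} (hx : Tame x) (L i : ℤ) (n : ℕ) :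
    Tame ((HypCrystal.eC a1 a2 L i)^[n] x) := by
  induction n with
  | zero => exact hx
  | succ n ih => rw [Function.iterate_succ_apply']; exact ih.eC a1 a2 L i

theorem phiC_congr {L : ℤ} {x y : ℤ → ℤ} (h : Agree L x y) (i : ℤ) :
    phiC a1 a2 L i x = phiC a1 a2 L i y := by
  unfold phiC
  congr 1
  ext s
  refine exists_congr fun k => and_congr_right fun hk => ?_
  rw [sigmaM_congr a1 a2 h hk]

theorem kmaxC_congr {L : ℤ} {x y : ℤ → ℤ} (h : Agree L x y) (i : ℤ) :
    kmaxC a1 a2 L i x = kmaxC a1 a2 L i y := by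
  unfold kmaxC
  congr 1
  ext k
  refine and_congr_right fun hk => ?_
  rw [sigmaM_congr a1 a2 h hk, phiC_congr a1 a2 h]

theorem Agree.lower {L : ℤ} {x y : ℤ → ℤ} (h : Agree L x y) (j : ℤ) :
    Agree L (lower x j) (lower y j) := by
  intro k hk
  unfold HypCrystal.lower
  by_cases hkj : k = j
  · subst hkj
    simp [h k hk]
  · simp [hkj, h k hk]

theorem Agree.eC_iterate {L : ℤ} {x y : ℤ → ℤ} (h : Agree L x y) (i : ℤ) (n : ℕ) :
    Agree L ((eC a1 a2 L i)^[n] x) ((eC a1 a2 L i)^[n] y) := by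
  induction n with
  | zero => exact h
  | succ n ih =>
    rw [Function.iterate_succ_apply', Function.iterate_succ_apply']
    rw [eC, eC, kmaxC_congr a1 a2 ih]
    exact ih.lower _

theorem phiC_eC {x : ℤ → ℤ} (hx : Tame x) (L e : ℤ) :
    phiC a1 a2 L (idx e) (eC a1 a2 L (idx e) x) = phiC a1 a2 L (idx e) x + 1 := by
  obtain ⟨⟨hm, hme, hms⟩, hmax⟩ := kmaxC_isGreatest a1 a2 hx L e
  have hmax' : ∀ k, k ≤ L → idx k = idx e → kmaxC a1 a2 L (idx e) x < k →
      sigmaM a1 a2 x k + 1 ≤ phiC a1 a2 L (idx e) x := by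
    intro k hk hke hlt
    have h1 := sigmaM_le_phiC a1 a2 hx hk hke
    rcases h1.lt_or_eq with h | h
    · omega
    · exact absurd (hmax ⟨hk, hke, h⟩) (by omega)
  refine (phiC_isGreatest a1 a2 (hx.eC a1 a2 L (idx e)) L e).unique ⟨⟨_, hm, hme, ?_⟩, ?_⟩
  · rw [eC, sigmaM_lower_self, hms]
  · rintro s ⟨k, hk, hke, rfl⟩
    have h1 := sigmaM_le_phiC a1 a2 hx hk hke
    rcases lt_trichotomy (kmaxC a1 a2 L (idx e) x) k with h | h | h
    · rw [eC, sigmaM_lower_of_lt a1 a2 hx h, pairJK,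
        if_pos (idx_eq_idx.1 (hme.trans hke.symm))]
      have := hmax' k hk hke h
      omega
    · subst h
      rw [eC, sigmaM_lower_self]
      omega
    · rw [eC, sigmaM_lower_of_gt _ _ _ h]
      omega

theorem phiC_eC_iterate {x : ℤ → ℤ} (hx : Tame x) (L e : ℤ) (n : ℕ) :
    phiC a1 a2 L (idx e) ((eC a1 a2 L (idx e))^[n] x) = phiC a1 a2 L (idx e) x + n := by
  induction n with
  | zero => simp
  | succ n ih =>
    rw [Function.iterate_succ_apply', phiC_eC a1 a2 (hx.eC_iterate a1 a2 L _ n), ih]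
    push_cast
    ring

theorem sigmaM_eC_below {x : ℤ → ℤ} (hx : Tame x) (L e : ℤ) :
    sigmaM a1 a2 (eC a1 a2 (L - 1) (idx e) x) L = sigmaM a1 a2 x L + pairJK a1 a2 e L := by
  obtain ⟨⟨hm, hme, -⟩, -⟩ := kmaxC_isGreatest a1 a2 hx (L - 1) e
  rw [eC, sigmaM_lower_of_lt a1 a2 hx (by omega), pairJK, pairJK, idx_eq_idx.1 hme]

theorem sigmaM_eC_below_iterate {x : ℤ → ℤ} (hx : Tame x) (L e : ℤ) (n : ℕ) :
    sigmaM a1 a2 ((eC a1 a2 (L - 1) (idx e))^[n] x) L =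
      sigmaM a1 a2 x L + pairJK a1 a2 e L * n := by
  induction n with
  | zero => simp
  | succ n ih =>
    rw [Function.iterate_succ_apply',
      sigmaM_eC_below a1 a2 (hx.eC_iterate a1 a2 (L - 1) _ n), ih]
    push_cast
    ring

theorem le_iff_le_sub_one_of_idx_ne {L i k : ℤ} (h : idx L ≠ i) (hk : idx k = i) :
    k ≤ L ↔ k ≤ L - 1 := by
  have : k ≠ L := by
    rintro rfl
    exact h hk
  omega

theorem phiC_of_idx_ne {L i : ℤ} (h : idx L ≠ i) (x : ℤ → ℤ) :
    phiC a1 a2 L i x = phiC a1 a2 (L - 1) i x := by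
  unfold phiC
  congr 1
  ext s
  refine exists_congr fun k => ?_
  constructor
  · rintro ⟨h1, h2, h3⟩
    exact ⟨(le_iff_le_sub_one_of_idx_ne h h2).1 h1, h2, h3⟩
  · rintro ⟨h1, h2, h3⟩
    exact ⟨(le_iff_le_sub_one_of_idx_ne h h2).2 h1, h2, h3⟩

theorem eC_of_idx_ne {L i : ℤ} (h : idx L ≠ i) : eC a1 a2 L i = eC a1 a2 (L - 1) i := by
  funext x
  unfold eC kmaxC
  rw [phiC_of_idx_ne a1 a2 h]
  congr 2
  ext k
  constructor
  · rintro ⟨h1, h2, h3⟩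
    exact ⟨(le_iff_le_sub_one_of_idx_ne h h2).1 h1, h2, h3⟩
  · rintro ⟨h1, h2, h3⟩
    exact ⟨(le_iff_le_sub_one_of_idx_ne h h2).2 h1, h2, h3⟩

theorem phiC_self {x : ℤ → ℤ} (hx : Tame x) (L : ℤ) :
    phiC a1 a2 L (idx L) x = max (sigmaM a1 a2 x L) (phiC a1 a2 (L - 1) (idx L) x) := by
  obtain ⟨⟨k, hk, hke, hks⟩, hmax⟩ := phiC_isGreatest a1 a2 hx (L - 1) L
  apply (phiC_isGreatest a1 a2 hx L L).unique
  constructor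
  · rcases max_choice (sigmaM a1 a2 x L) (phiC a1 a2 (L - 1) (idx L) x) with h | h <;> rw [h]
    · exact ⟨L, le_rfl, rfl, rfl⟩
    · exact ⟨k, by omega, hke, hks⟩
  · rintro s ⟨m, hm, hme, rfl⟩
    rcases hm.lt_or_eq with h | rfl
    · exact le_max_of_le_right (hmax ⟨m, by omega, hme, rfl⟩)
    · exact le_max_left _ _

theorem eC_self_of_le {x : ℤ → ℤ} (hx : Tame x) {L : ℤ}
    (h : phiC a1 a2 (L - 1) (idx L) x ≤ sigmaM a1 a2 x L) :
    eC a1 a2 L (idx L) x = lower x L := by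
  rw [eC]
  congr 1
  refine (kmaxC_isGreatest a1 a2 hx L L).unique ⟨⟨le_rfl, rfl, ?_⟩, fun k hk => hk.1⟩
  rw [phiC_self a1 a2 hx, max_eq_left h]

theorem eC_self_of_lt {x : ℤ → ℤ} (hx : Tame x) {L : ℤ}
    (h : sigmaM a1 a2 x L < phiC a1 a2 (L - 1) (idx L) x) :
    eC a1 a2 L (idx L) x = eC a1 a2 (L - 1) (idx L) x := by
  have hphi : phiC a1 a2 L (idx L) x = phiC a1 a2 (L - 1) (idx L) x := by
    rw [phiC_self a1 a2 hx, max_eq_right h.le]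
  obtain ⟨⟨hm, hme, hms⟩, hmax⟩ := kmaxC_isGreatest a1 a2 hx (L - 1) L
  rw [eC, eC]
  congr 1
  refine (kmaxC_isGreatest a1 a2 hx L L).unique ⟨⟨by omega, hme, hms.trans hphi.symm⟩, ?_⟩
  rintro k ⟨hk, hke, hks⟩
  rw [hphi] at hks
  refine hmax ⟨?_, hke, hks⟩
  have : k ≠ L := by
    rintro rfl
    omega
  omega

theorem phiC_self_eq_zero_iff {x : ℤ → ℤ} (hx : Tame x) (L : ℤ) :
    phiC a1 a2 L (idx L) x = 0 ↔
      sigmaM a1 a2 x L ≤ 0 ∧ phiC a1 a2 (L - 1) (idx L) x = 0 := by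
  have := phiC_nonneg a1 a2 hx (L - 1) L
  rw [phiC_self a1 a2 hx]
  omega

/-- Iterating `ẽ` from an element with `φ = 0`: the first `-σ_L` applications act below the top
position `L`, the remaining ones at `L`. -/
theorem eC_self_iterate {x : ℤ → ℤ} (hx : Tame x) {L : ℤ} (h : phiC a1 a2 L (idx L) x = 0)
    (n : ℕ) :
    Agree (L - 1) ((eC a1 a2 L (idx L))^[n] x)
        ((eC a1 a2 (L - 1) (idx L))^[min n (-sigmaM a1 a2 x L).toNat] x) ∧
      sigmaM a1 a2 ((eC a1 a2 L (idx L))^[n] x) L =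
        sigmaM a1 a2 x L + n + min (n : ℤ) (-sigmaM a1 a2 x L) := by
  obtain ⟨hs, hp⟩ := (phiC_self_eq_zero_iff a1 a2 hx L).1 h
  induction n with
  | zero =>
    have : min (((0 : ℕ)) : ℤ) (-sigmaM a1 a2 x L) = 0 := by omega
    exact ⟨fun _ _ => by simp, by rw [this]; simp⟩
  | succ n ih =>
    obtain ⟨ih1, ih2⟩ := ih
    have ht := hx.eC_iterate a1 a2 L (idx L) n
    have hphi : phiC a1 a2 (L - 1) (idx L) ((eC a1 a2 L (idx L))^[n] x) =
        min (n : ℤ) (-sigmaM a1 a2 x L) := by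
      rw [phiC_congr a1 a2 ih1, phiC_eC_iterate a1 a2 hx, hp]
      omega
    rw [Function.iterate_succ_apply']
    by_cases hn : (n : ℤ) < -sigmaM a1 a2 x L
    · have hlt : sigmaM a1 a2 ((eC a1 a2 L (idx L))^[n] x) L <
          phiC a1 a2 (L - 1) (idx L) ((eC a1 a2 L (idx L))^[n] x) := by omega
      rw [eC_self_of_lt a1 a2 ht hlt]
      constructor
      · have h1 : min n (-sigmaM a1 a2 x L).toNat = n := by omega
        have h2 : min (n + 1) (-sigmaM a1 a2 x L).toNat = n + 1 := by omega
        rw [h2, Function.iterate_succ_apply']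
        rw [h1] at ih1
        exact ih1.eC_iterate a1 a2 (idx L) 1
      · rw [sigmaM_eC_below a1 a2 ht, ih2, pairJK, if_pos rfl]
        push_cast
        omega
    · have hle : phiC a1 a2 (L - 1) (idx L) ((eC a1 a2 L (idx L))^[n] x) ≤
          sigmaM a1 a2 ((eC a1 a2 L (idx L))^[n] x) L := by omega
      rw [eC_self_of_le a1 a2 ht hle]
      constructor
      · have h1 : min (n + 1) (-sigmaM a1 a2 x L).toNat = min n (-sigmaM a1 a2 x L).toNat := by
          omega
        rw [h1]
        intro k hk
        rw [lower, Function.update_of_ne (by omega), ih1 k hk]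
      · rw [sigmaM_lower_self, ih2]
        push_cast
        omega

theorem chainC_succ (L : ℤ) (y : ℕ → ℕ) (j : ℕ) :
    chainC a1 a2 L y (j + 1) =
      (eC a1 a2 L (idx (L + j)))^[y j] (chainC a1 a2 L y j) := rfl

theorem chainC_tame (L : ℤ) (y : ℕ → ℕ) (j : ℕ) : Tame (chainC a1 a2 L y j) := by
  induction j with
  | zero => exact Tame.zero
  | succ j ih => exact ih.eC_iterate a1 a2 L _ _

theorem phiC_zero (L e : ℤ) : phiC a1 a2 L (idx e) (fun _ => 0) = 0 := by
  obtain ⟨⟨k, -, -, hk⟩, -⟩ := phiC_isGreatest a1 a2 Tame.zero L e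
  rw [← hk, sigmaM_zero]

theorem isString_succ (L : ℤ) (y : ℕ → ℕ) (n : ℕ) :
    IsString a1 a2 L y (n + 1) ↔
      IsString a1 a2 L y n ∧ phiC a1 a2 L (idx (L + n)) (chainC a1 a2 L y n) = 0 := by
  constructor
  · exact fun h => ⟨fun j hj => h j (by omega), h n (by omega)⟩
  · rintro ⟨h1, h2⟩ j hj
    rcases (Nat.lt_succ_iff.1 hj).lt_or_eq with h | rfl
    · exact h1 j h
    · exact h2

/-- Removing the top position from a chain. -/
theorem isString_peel (L : ℤ) (y : ℕ → ℕ) (n : ℕ) :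
    (IsString a1 a2 L y (n + 1) ↔
      IsString a1 a2 (L - 1) (fun j => below (aIdx a1 a2 L) y (j + 1)) n ∧
        ∀ j : ℕ, j ≤ n → j % 2 = 0 → topSigma (aIdx a1 a2 L) y j ≤ 0) ∧
    (IsString a1 a2 L y (n + 1) →
      Agree (L - 1) (chainC a1 a2 L y (n + 1))
        (chainC a1 a2 (L - 1) (fun j => below (aIdx a1 a2 L) y (j + 1)) n) ∧
      sigmaM a1 a2 (chainC a1 a2 L y (n + 1)) L = topSigma (aIdx a1 a2 L) y (n + 1)) := by
  induction n with
  | zero =>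
    refine ⟨iff_of_true ?_ ⟨fun j hj => by omega, ?_⟩, fun _ => ?_⟩
    · intro j hj
      obtain rfl : j = 0 := by omega
      exact phiC_zero a1 a2 L _
    · intro j hj _
      obtain rfl : j = 0 := by omega
      exact le_rfl
    · have h := eC_self_iterate a1 a2 Tame.zero (phiC_zero a1 a2 L L) (y 0)
      rw [sigmaM_zero] at h
      simpa [chainC, topSigma] using h
  | succ n ih =>
    obtain ⟨ih1, ih2⟩ := ih
    set a := aIdx a1 a2 L with ha
    set y' : ℕ → ℕ := fun j => below a y (j + 1) with hy'
    have ht := chainC_tame a1 a2 L y (n + 1)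
    have hidx : idx (L + (n + 1 : ℕ)) = idx (L - 1 + n) := idx_eq_idx.2 (by push_cast; omega)
    by_cases hpar : (n + 1) % 2 = 0
    · have hL : idx (L + (n + 1 : ℕ)) = idx L := idx_eq_idx.2 (by push_cast; omega)
      constructor
      · rw [isString_succ _ _ L y (n + 1), isString_succ _ _ (L - 1), hL,
          phiC_self_eq_zero_iff a1 a2 ht, ← hidx, hL]
        constructor
        · rintro ⟨h1, h2, h3⟩
          obtain ⟨h4, h5⟩ := ih1.1 h1
          obtain ⟨h6, h7⟩ := ih2 h1
          rw [phiC_congr a1 a2 h6] at h3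
          refine ⟨⟨h4, h3⟩, fun j hj hj2 => ?_⟩
          rcases hj.lt_or_eq with h | rfl
          · exact h5 j (by omega) hj2
          · rwa [h7] at h2
        · rintro ⟨⟨h4, h3⟩, h5⟩
          have h1 := ih1.2 ⟨h4, fun j hj => h5 j (by omega)⟩
          obtain ⟨h6, h7⟩ := ih2 h1
          refine ⟨h1, ?_, ?_⟩
          · rw [h7]
            exact h5 _ le_rfl hpar
          · rw [phiC_congr a1 a2 h6]
            exact h3
      · intro h
        obtain ⟨h1, h2⟩ := (isString_succ _ _ L y (n + 1)).1 h
        rw [hL] at h2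
        obtain ⟨h6, h7⟩ := ih2 h1
        have h8 := eC_self_iterate a1 a2 ht h2 (y (n + 1))
        rw [h7] at h8
        rw [chainC, hL]
        refine ⟨?_, ?_⟩
        · have h9 := h6.eC_iterate a1 a2 (idx L) (y' n)
          rw [chainC_succ a1 a2 (L - 1) y' n, ← hidx, hL]
          have h10 : y' n = min (y (n + 1)) (-topSigma a y (n + 1)).toNat := by
            simp only [hy', below, if_pos hpar]
          rw [← h10] at h8
          exact fun k hk => (h8.1 k hk).trans (h9 k hk)
        · rw [h8.2]
          conv_rhs => rw [topSigma, if_pos hpar]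
    · have hL : idx L ≠ idx (L + (n + 1 : ℕ)) := fun h => by
        have := idx_eq_idx.1 h
        push_cast at this
        omega
      constructor
      · rw [isString_succ _ _ L y (n + 1), isString_succ _ _ (L - 1), phiC_of_idx_ne a1 a2 hL,
          ← hidx]
        constructor
        · rintro ⟨h1, h3⟩
          obtain ⟨h4, h5⟩ := ih1.1 h1
          obtain ⟨h6, h7⟩ := ih2 h1
          rw [phiC_congr a1 a2 h6] at h3
          exact ⟨⟨h4, h3⟩, fun j hj hj2 => h5 j (by grind) hj2⟩
        · rintro ⟨⟨h4, h3⟩, h5⟩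
          have h1 := ih1.2 ⟨h4, fun j hj => h5 j (by omega)⟩
          obtain ⟨h6, h7⟩ := ih2 h1
          refine ⟨h1, ?_⟩
          rw [phiC_congr a1 a2 h6]
          exact h3
      · intro h
        obtain ⟨h1, h2⟩ := (isString_succ _ _ L y (n + 1)).1 h
        obtain ⟨h6, h7⟩ := ih2 h1
        rw [chainC, eC_of_idx_ne a1 a2 hL]
        refine ⟨?_, ?_⟩
        · have h9 := h6.eC_iterate a1 a2 (idx (L + (n + 1 : ℕ))) (y (n + 1))
          rw [chainC_succ a1 a2 (L - 1) y' n, ← hidx]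
          have h10 : y' n = y (n + 1) := by simp only [hy', below, if_neg hpar]
          rw [h10]
          exact h9
        · rw [sigmaM_eC_below_iterate a1 a2 ht, h7]
          conv_rhs => rw [topSigma, if_neg hpar]
          rw [pairJK, if_neg (fun h => hL (idx_eq_idx.2 h.symm)), ha, aIdx]
          split_ifs <;> ring

end Cut

section Arithmetic

theorem recurrence_pos {d A : ℕ → ℤ} (h0 : d 0 = 0) (h1 : d 1 = 1) (hA : ∀ j, 1 ≤ A j)
    (hAA : ∀ j, 4 ≤ A j * A (j + 1)) (hd : ∀ j, d (j + 2) = A j * d (j + 1) - d j) (j : ℕ) :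
    0 < d (j + 1) := by
  suffices h : 0 < d (j + 1) ∧ 2 * d j ≤ A j * d (j + 1) from h.1
  induction j with
  | zero => simp [h0, h1, le_trans zero_le_one (hA 0)]
  | succ j ih =>
    obtain ⟨ih1, ih2⟩ := ih
    have hpos : 0 < A j * d (j + 1) := mul_pos (hA j) ih1
    have hj := hd j
    have h2 : A j * d (j + 1) ≤ 2 * d (j + 2) := by linarith
    refine ⟨by show 0 < d (j + 2); linarith, ?_⟩
    show 2 * d (j + 1) ≤ A (j + 1) * d (j + 2)
    have h3 := mul_le_mul_of_nonneg_left h2 (le_trans zero_le_one (hA (j + 1)))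
    have h4 := mul_le_mul_of_nonneg_right (hAA j) ih1.le
    linarith [mul_assoc (A j) (A (j + 1)) (d (j + 1)), mul_left_comm (A j) (A (j + 1)) (d (j + 1))]

variable {a1 a2 : ℤ}

theorem dseq_zero (e : ℤ) : dseq a1 a2 e 0 = 0 := by simp [dseq, cseq, cseq']

theorem dseq_one (e : ℤ) : dseq a1 a2 e 1 = 1 := by simp [dseq, cseq, cseq']

theorem dseq_add_two (e : ℤ) (j : ℕ) :
    dseq a1 a2 e (j + 2) = aIdx a1 a2 (e + j) * dseq a1 a2 e (j + 1) - dseq a1 a2 e j := by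
  unfold dseq aIdx
  split_ifs <;> simp only [cseq, cseq'] <;> split_ifs <;> first | rfl | omega

theorem dseq_congr {e e' : ℤ} (h : e % 2 = e' % 2) (j : ℕ) :
    dseq a1 a2 e j = dseq a1 a2 e' j := by
  rw [dseq, dseq, h]

theorem dseq_pos (ha1 : 1 ≤ a1) (ha2 : 1 ≤ a2) (ha : 4 ≤ a1 * a2) (e : ℤ) (j : ℕ) :
    0 < dseq a1 a2 e (j + 1) := by
  refine recurrence_pos (A := fun j => aIdx a1 a2 (e + j)) (dseq_zero e) (dseq_one e) ?_ ?_
    (dseq_add_two e) j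
  · intro j
    simp only [aIdx]
    split_ifs <;> assumption
  · intro j
    simp only [aIdx]
    push_cast
    split_ifs
    · omega
    · exact ha
    · rwa [mul_comm]
    · omega

theorem dseq_nonneg (ha1 : 1 ≤ a1) (ha2 : 1 ≤ a2) (ha : 4 ≤ a1 * a2) (e : ℤ) (j : ℕ) :
    0 ≤ dseq a1 a2 e j := by
  cases j with
  | zero => rw [dseq_zero]
  | succ j => exact (dseq_pos ha1 ha2 ha e j).le

theorem topSigma_add_two (a : ℤ) (y : ℕ → ℕ) {j : ℕ} (hj : j % 2 = 0)
    (h : topSigma a y j ≤ 0) :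
    -topSigma a y (j + 2) = a * y (j + 1) - y j + (-topSigma a y j - below a y j) := by
  have hj' : ¬(j + 1) % 2 = 0 := by omega
  rw [topSigma, if_neg hj', topSigma, if_pos hj, below, if_pos hj]
  push_cast
  rw [Int.toNat_of_nonneg (by omega)]
  ring

theorem below_le (a : ℤ) (y : ℕ → ℕ) (j : ℕ) : below a y j ≤ y j := by
  unfold below
  split_ifs <;> omega

theorem below_le_topSigma (a : ℤ) (y : ℕ → ℕ) {j : ℕ} (hj : j % 2 = 0)
    (h : topSigma a y j ≤ 0) : (below a y j : ℤ) ≤ -topSigma a y j := by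
  rw [below, if_pos hj]
  omega

/-- The linear inequalities on exponents are compatible with removal of the top position. -/
theorem inequalities_peel (a : ℤ) (y : ℕ → ℕ) (n : ℕ) (d : ℕ → ℤ) (h0 : d 0 = 0)
    (hpos : ∀ j, 0 < d (j + 1))
    (hrec : ∀ m, m % 2 = 1 → m < n → d (n - m + 1) = a * d (n - m) - d (n - m - 1)) :
    (∀ m : ℕ, m + 1 < n → d (n - (m + 1)) * y m ≤ d (n - m) * y (m + 1)) ↔
      (∀ m : ℕ, m + 2 < n →
        d (n - (m + 2)) * below a y (m + 1) ≤ d (n - (m + 1)) * below a y (m + 2)) ∧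
      ∀ j : ℕ, j ≤ n → j % 2 = 0 → topSigma a y j ≤ 0 := by
  have hd : ∀ j, 0 ≤ d j := fun j => by
    cases j with
    | zero => exact h0.ge
    | succ j => exact (hpos j).le
  have hrec' : ∀ i, i % 2 = 0 → i + 2 ≤ n →
      d (n - i) = a * d (n - (i + 1)) - d (n - (i + 2)) := by
    intro i hi hin
    have h := hrec (i + 1) (by omega) (by omega)
    rwa [show n - (i + 1) + 1 = n - i by omega, show n - (i + 1) - 1 = n - (i + 2) by omega] at h
  have hodd : ∀ i, i % 2 = 0 → below a y (i + 1) = y (i + 1) := fun i hi =>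
    if_neg (by omega)
  constructor
  · intro H
    have hkey : ∀ i, i % 2 = 0 → i + 2 ≤ n → topSigma a y i ≤ 0 →
        d (n - (i + 2)) * y (i + 1) ≤ d (n - (i + 1)) * -topSigma a y (i + 2) := by
      intro i hi hin hs
      have h1 := H i (by omega)
      rw [hrec' i hi hin] at h1
      have h2 : a * y (i + 1) - y i ≤ -topSigma a y (i + 2) := by
        rw [topSigma_add_two a y hi hs]
        linarith [below_le_topSigma a y hi hs]
      have h3 := mul_le_mul_of_nonneg_left h2 (hd (n - (i + 1)))
      linarith
    have htop : ∀ k, 2 * k ≤ n → topSigma a y (2 * k) ≤ 0 := by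
      intro k
      induction k with
      | zero => exact fun _ => le_rfl
      | succ k ih =>
        intro hk
        have h1 := hkey (2 * k) (by omega) (by omega) (ih (by omega))
        have h2 : 0 ≤ d (n - (2 * k + 2)) * (y (2 * k + 1) : ℤ) :=
          mul_nonneg (hd _) (Int.natCast_nonneg _)
        have h3 : 0 < d (n - (2 * k + 1)) := by
          have := hpos (n - (2 * k + 2))
          rwa [show n - (2 * k + 2) + 1 = n - (2 * k + 1) by omega] at this
        have h4 := nonneg_of_mul_nonneg_right (h2.trans h1) h3
        show topSigma a y (2 * k + 2) ≤ 0
        omega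
    have htop' : ∀ j : ℕ, j ≤ n → j % 2 = 0 → topSigma a y j ≤ 0 := by
      intro j hj hj2
      have := htop (j / 2) (by omega)
      rwa [show 2 * (j / 2) = j by omega] at this
    refine ⟨fun m hm => ?_, htop'⟩
    rcases Nat.mod_two_eq_zero_or_one m with hm2 | hm2
    · have hb : (below a y (m + 2) : ℤ) = min (y (m + 2) : ℤ) (-topSigma a y (m + 2)) := by
        have := htop' (m + 2) (by omega) (by omega)
        rw [below, if_pos (by omega)]
        omega
      rw [hodd m hm2, hb]
      rcases min_choice (y (m + 2) : ℤ) (-topSigma a y (m + 2)) with h | h <;> rw [h]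
      · exact H (m + 1) hm
      · exact hkey m hm2 (by omega) (htop' m (by omega) hm2)
    · rw [hodd (m + 1) (by omega)]
      have h1 : (below a y (m + 1) : ℤ) ≤ y (m + 1) := by exact_mod_cast below_le a y (m + 1)
      exact (mul_le_mul_of_nonneg_left h1 (hd _)).trans (H (m + 1) hm)
  · rintro ⟨H, htop⟩ m hm
    rcases Nat.mod_two_eq_zero_or_one m with hm2 | hm2
    · have hs := htop m (by omega) hm2
      rcases (below_le_topSigma a y hm2 hs).lt_or_eq with h | h
      · have hy : below a y m = y m := by
          rw [below, if_pos hm2] at h ⊢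
          omega
        obtain ⟨i, rfl⟩ : ∃ i, m = i + 1 := by
          refine Nat.exists_eq_succ_of_ne_zero ?_
          rintro rfl
          simp only [topSigma] at h
          omega
        have := H i (by omega)
        rwa [hy, hodd (i + 1) hm2] at this
      · have h1 := topSigma_add_two a y hm2 hs
        have hs' := htop (m + 2) (by omega) (by omega)
        have h2 : d (n - (m + 2)) * (y (m + 1) : ℤ) ≤
            d (n - (m + 1)) * -topSigma a y (m + 2) := by
          rcases (show m + 2 ≤ n by omega).lt_or_eq with hlt | heq
          · have := H m hlt
            rw [hodd m hm2] at this
            exact this.trans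
              (mul_le_mul_of_nonneg_left (below_le_topSigma a y (by omega) hs') (hd _))
          · rw [show n - (m + 2) = 0 by omega, h0, zero_mul]
            exact mul_nonneg (hd _) (by omega)
        rw [h1, h, sub_self, add_zero] at h2
        rw [hrec' m hm2 (by omega)]
        linarith
    · obtain ⟨i, rfl⟩ : ∃ i, m = i + 1 := Nat.exists_eq_succ_of_ne_zero (by omega)
      have h1 := H i hm
      rw [hodd i (by omega)] at h1
      have h2 : (below a y (i + 2) : ℤ) ≤ y (i + 2) := by exact_mod_cast below_le a y (i + 2)
      exact h1.trans (mul_le_mul_of_nonneg_left h2 (hd _))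

theorem aIdx_congr {e e' : ℤ} (h : e % 2 = e' % 2) : aIdx a1 a2 e = aIdx a1 a2 e' := by
  rw [aIdx, aIdx, h]

/-- The string cone is cut out by the inequalities of the polyhedral realization. -/
theorem isString_iff (ha1 : 1 ≤ a1) (ha2 : 1 ≤ a2) (ha : 4 ≤ a1 * a2) (n : ℕ) (L : ℤ)
    (y : ℕ → ℕ) :
    IsString a1 a2 L y (n + 1) ↔ ∀ m : ℕ, m + 1 < n →
      dseq a1 a2 (L + n) (n - (m + 1)) * y m ≤ dseq a1 a2 (L + n) (n - m) * y (m + 1) := by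
  induction n generalizing L y with
  | zero =>
    refine iff_of_true (fun j hj => ?_) (fun m hm => by omega)
    obtain rfl : j = 0 := by omega
    exact phiC_zero a1 a2 L _
  | succ n ih =>
    rw [(isString_peel a1 a2 L y (n + 1)).1, ih, inequalities_peel (aIdx a1 a2 L) y (n + 1)
      (dseq a1 a2 (L + (n + 1 : ℕ))) (dseq_zero _) (dseq_pos ha1 ha2 ha _)]
    · refine and_congr_left fun _ => forall_congr' fun m => ?_
      rw [dseq_congr (show (L - 1 + n) % 2 = (L + (n + 1 : ℕ)) % 2 by push_cast; omega),
        dseq_congr (show (L - 1 + n) % 2 = (L + (n + 1 : ℕ)) % 2 by push_cast; omega),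
        show n + 1 - (m + 2) = n - (m + 1) by omega, show n + 1 - (m + 1) = n - m by omega]
      exact imp_congr_left (by omega)
    · intro m hm hmn
      have h := dseq_add_two (a1 := a1) (a2 := a2) (L + (n + 1 : ℕ)) (n + 1 - m - 1)
      rwa [show n + 1 - m - 1 + 2 = n + 1 - m + 1 by omega,
        show n + 1 - m - 1 + 1 = n + 1 - m by omega,
        aIdx_congr (show (L + (n + 1 : ℕ) + (n + 1 - m - 1 : ℕ)) % 2 = L % 2 by omega)] at h

end Arithmetic

theorem phiC_top (a1 a2 i : ℤ) (x : ℤ → ℤ) : phiC a1 a2 0 i x = phiMf a1 a2 x i := rfl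

theorem eC_top (a1 a2 i : ℤ) : eC a1 a2 0 i = eM a1 a2 i := rfl

theorem chainC_top (a1 a2 : ℤ) (g : ℤ → ℕ) (n : ℕ) :
    chainC a1 a2 0 (fun m => if m = 0 then 0 else g m) (n + 1) =
      eMposChain a1 a2 g n (fun _ => 0) := by
  induction n with
  | zero => simp [chainC, eMposChain]
  | succ n ih =>
    rw [chainC_succ, ih, eMposChain, eMiter, eC_top]
    simp

end HypCrystal

open HypCrystal in
theorem z2_mem_XMinus_iff
    (a1 a2 : ℤ) (ha1 : 1 ≤ a1) (ha2 : 1 ≤ a2) (ha : 4 < a1 * a2)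
    (k1 k2 : ℤ) (hk1 : 0 < k1) (hk2 : 0 < k2)
    (hreg : 2 ≤ a1 → 2 ≤ a2 →
      (k2 ≤ k1 ∧ k1 < (a1 - 1) * k2) ∨ (k1 < k2 ∧ k2 ≤ (a2 - 1) * k1))
    (hdeg1 : a1 = 1 → 2 * k1 ≤ k2 ∧ k2 ≤ (a2 - 2) * k1)
    (hdeg2 : a2 = 1 → 2 * k2 ≤ k1 ∧ k1 ≤ (a1 - 2) * k2)
    (x : ℤ → ℤ) (hx : XPlusMem a1 a2 x)
    (hxp : ∀ m : ℤ, 1 ≤ m → x m ≤ pseq a1 a2 k1 k2 m)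
    (l : ℤ) (hl : 1 ≤ l) :
    -- `z2 = (x_{2l} − p_{2l}, …, x_1 − p_1, 0, 0, …)`
    ((XMinusMem a1 a2 (fun j => if 1 ≤ j then 0 else
        if -2 * l + 1 ≤ j then x (j + 2 * l) - pseq a1 a2 k1 k2 (j + 2 * l) else 0)) ↔
      (∀ j : ℤ, -2 * l + 2 ≤ j → j ≤ -1 →
        cseq' a1 a2 (1 - j).toNat * (x (j + 2 * l) - pseq a1 a2 k1 k2 (j + 2 * l)) -
          cseq' a1 a2 (-j).toNat * (x (j + 2 * l - 1) - pseq a1 a2 k1 k2 (j + 2 * l - 1)) ≤ 0)) ∧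
    ((XMinusMem a1 a2 (fun j => if 1 ≤ j then 0 else
        if -2 * l + 1 ≤ j then x (j + 2 * l) - pseq a1 a2 k1 k2 (j + 2 * l) else 0)) ↔
      (∀ j : ℤ, 1 ≤ j → j ≤ 2 * l →
        phiMf a1 a2
          (eMposChain a1 a2 (fun m => (pseq a1 a2 k1 k2 m - x m).toNat) (j - 1).toNat
            (fun _ => 0))
          (idx j) = 0)) := by
  have hc : ∀ n : ℕ, 0 ≤ cseq' a1 a2 n := fun n => by
    simpa [dseq] using dseq_nonneg ha1 ha2 ha.le 0 n
  set p := pseq a1 a2 k1 k2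
  have h12 : (XMinusMem a1 a2 (fun j => if 1 ≤ j then 0 else
        if -2 * l + 1 ≤ j then x (j + 2 * l) - p (j + 2 * l) else 0)) ↔
      (∀ j : ℤ, -2 * l + 2 ≤ j → j ≤ -1 →
        cseq' a1 a2 (1 - j).toNat * (x (j + 2 * l) - p (j + 2 * l)) -
          cseq' a1 a2 (-j).toNat * (x (j + 2 * l - 1) - p (j + 2 * l - 1)) ≤ 0) := by
    constructor
    · rintro ⟨-, h⟩ j hj1 hj2
      have := h j (by omega)
      simp only [] at this
      rwa [if_neg (by omega), if_pos (by omega), if_neg (by omega), if_pos (by omega),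
        show j - 1 + 2 * l = j + 2 * l - 1 by ring] at this
    · intro h
      refine ⟨⟨fun k hk => if_pos hk, fun k => ?_, (2 * l).toNat, fun k hk => ?_⟩,
        fun j hj => ?_⟩
      · simp only []
        split_ifs with h1 h2
        · exact le_rfl
        · have := hxp (k + 2 * l) (by omega)
          omega
        · exact le_rfl
      · simp only []
        rw [if_neg (by omega), if_neg (by omega)]
      · simp only []
        rw [if_neg (show ¬1 ≤ j by omega), if_neg (show ¬1 ≤ j - 1 by omega)]
        by_cases h1 : -2 * l + 1 ≤ j
        · have hneg := mul_nonpos_of_nonneg_of_nonpos (hc (1 - j).toNat)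
            (sub_nonpos.2 (hxp (j + 2 * l) (by omega)))
          rw [if_pos h1]
          by_cases h2 : -2 * l + 1 ≤ j - 1
          · rw [if_pos h2]
            rcases hj.lt_or_eq with h3 | rfl
            · have := h j (by omega) (by omega)
              rwa [show j - 1 + 2 * l = j + 2 * l - 1 by ring]
            · simpa [cseq'] using hneg
          · rw [if_neg h2]
            simpa using hneg
        · rw [if_neg h1, if_neg (by omega)]
          simp
  refine ⟨h12, h12.trans ?_⟩
  set g : ℤ → ℕ := fun m => (p m - x m).toNat with hg
  have hgp : ∀ m : ℤ, 1 ≤ m → (g m : ℤ) = -(x m - p m) := fun m hm => by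
    have := hxp m hm
    simp only [hg]
    omega
  have hstring : (∀ j : ℤ, 1 ≤ j → j ≤ 2 * l →
      phiMf a1 a2 (eMposChain a1 a2 g (j - 1).toNat (fun _ => 0)) (idx j) = 0) ↔
      IsString a1 a2 0 (fun m => if m = 0 then 0 else g m) ((2 * l).toNat + 1) := by
    constructor
    · intro h j hj
      cases j with
      | zero => exact phiC_zero a1 a2 0 _
      | succ j =>
        have := h (j + 1) (by omega) (by omega)
        rw [chainC_top, phiC_top]
        simpa using this
    · intro h j hj1 hj2
      have := h ((j - 1).toNat + 1) (by omega)
      rw [chainC_top, phiC_top] at this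
      rwa [show (0 : ℤ) + ((j - 1).toNat + 1 : ℕ) = j by omega] at this
  rw [hstring, isString_iff ha1 ha2 ha.le]
  have hd : ∀ n, dseq a1 a2 (0 + ((2 * l).toNat : ℤ)) n = cseq' a1 a2 n := fun n =>
    if_neg (by omega)
  simp only [hd]
  constructor
  · intro h m hm
    cases m with
    | zero =>
      rw [if_pos rfl, Nat.cast_zero, mul_zero]
      exact mul_nonneg (hc _) (Int.natCast_nonneg _)
    | succ m =>
      have := h (m + 2 - 2 * l) (by omega) (by omega)
      rw [show (1 - ((m : ℤ) + 2 - 2 * l)).toNat = (2 * l).toNat - (m + 1) by omega,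
        show (-((m : ℤ) + 2 - 2 * l)).toNat = (2 * l).toNat - (m + 1 + 1) by omega,
        show (m : ℤ) + 2 - 2 * l + 2 * l = (m + 1 + 1 : ℕ) by push_cast; ring,
        show ((m + 1 + 1 : ℕ) : ℤ) - 1 = (m + 1 : ℕ) by push_cast; ring] at this
      rw [if_neg (by omega), if_neg (by omega), hgp _ (by omega), hgp _ (by omega)]
      linarith
  · intro h j hj1 hj2
    have := h (j + 2 * l - 1).toNat (by omega)
    rw [if_neg (by omega), if_neg (by omega), hgp _ (by omega), hgp _ (by omega),
      show (((j + 2 * l - 1).toNat + 1 : ℕ) : ℤ) = j + 2 * l by omega,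
      show (((j + 2 * l - 1).toNat : ℕ) : ℤ) = j + 2 * l - 1 by omega,
      show (2 * l).toNat - ((j + 2 * l - 1).toNat + 1) = (-j).toNat by omega,
      show (2 * l).toNat - (j + 2 * l - 1).toNat = (1 - j).toNat by omega] at this
    linarith
end
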